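/- Let n ≥ 2 and let K ⊂ ℝⁿ be a convex body. If there exists a point X₀ ∈ ∂K at which K has positive generalized Gauss curvature, then K is not a local maximizer for the isotropy constant L; that is, for every ε > 0 there exists a convex body K' ⊂ ℝⁿ with Hausdorff distance d(K', K) < ε and L_{K'} > L_K. -/

import Mathlib

open MeasureTheory Metric Set Filter
open scoped InnerProductSpace Topology

noncomputable section

/-- A convex body in ℝⁿ: a compact convex set with nonempty interior. -/
def IsConvexBody {n : ℕ} (K : Set (EuclideanSpace ℝ (Fin n))) : Prop :=
  IsCompact K ∧ Convex ℝ K ∧ (interior K).Nonempty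

/-- The centroid of a set. -/
def centroid {n : ℕ} (K : Set (EuclideanSpace ℝ (Fin n))) : EuclideanSpace ℝ (Fin n) :=
  ((volume K).toReal)⁻¹ • ∫ x in K, x

/-- `(1/n!) ∫_{A}⋯∫_{A} det(X₁ − g, …, Xₙ − g)² dX₁ ⋯ dXₙ`. -/
def detInt {n : ℕ} (A : Set (EuclideanSpace ℝ (Fin n))) (g : EuclideanSpace ℝ (Fin n)) : ℝ :=
  ((n.factorial : ℝ))⁻¹ *
    ∫ X in Set.univ.pi (fun _ : Fin n => A),
      (Matrix.det (Matrix.of fun i j : Fin n => X j i - g i)) ^ 2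
      ∂(Measure.pi fun _ : Fin n => volume)

/-- `M_K^{2n}`, the 2n-th power of the isotropy parameter of a convex body. -/
def Mpow2n {n : ℕ} (K : Set (EuclideanSpace ℝ (Fin n))) : ℝ := detInt K (centroid K)

/-- The isotropy constant `L_K = M_K / |K|^{(n+2)/(2n)}` of a convex body. -/
def isoL (n : ℕ) (K : Set (EuclideanSpace ℝ (Fin n))) : ℝ :=
  (Mpow2n K) ^ ((2 * (n : ℝ)))⁻¹ / (volume K).toReal ^ (((n : ℝ) + 2) / (2 * n))

/-- `K` is isotropic with isotropy parameter `M`. -/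
def IsIsotropic {n : ℕ} (K : Set (EuclideanSpace ℝ (Fin n))) (M : ℝ) : Prop :=
  0 < M ∧ (∫ x in K, x) = 0 ∧
    ∀ y : EuclideanSpace ℝ (Fin n), (∫ x in K, (⟪x, y⟫_ℝ) ^ 2) = M ^ 2 * ‖y‖ ^ 2

/-- `(N, q)` witnesses positive generalized Gauss curvature of `K` at `X₀`. -/
def CurvWitness {n : ℕ} (K : Set (EuclideanSpace ℝ (Fin n))) (X₀ N : EuclideanSpace ℝ (Fin n))
    (q : QuadraticForm ℝ (EuclideanSpace ℝ (Fin n))) : Prop :=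
  ‖N‖ = 1 ∧ (∀ x ∈ K, 0 ≤ ⟪x - X₀, N⟫_ℝ) ∧
  (∀ Y : EuclideanSpace ℝ (Fin n), ⟪Y, N⟫_ℝ = 0 → Y ≠ 0 → 0 < q Y) ∧
  ∀ ε > (0 : ℝ), ∃ a > (0 : ℝ), ∀ (Y : EuclideanSpace ℝ (Fin n)) (y : ℝ), ⟪Y, N⟫_ℝ = 0 →
    X₀ + Y + y • N ∈ frontier K ∩ Metric.ball X₀ a →
    (1 - ε) * q Y ≤ y ∧ y ≤ (1 + ε) * q Y

/-- `K` has positive generalized Gauss curvature at `X₀`. -/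
def HasPosGenCurvature {n : ℕ} (K : Set (EuclideanSpace ℝ (Fin n)))
    (X₀ : EuclideanSpace ℝ (Fin n)) : Prop :=
  ∃ N q, CurvWitness K X₀ N q

/-- `K` is a local maximizer for the isotropy constant (Hausdorff distance). -/
def IsLocalMaxIso {n : ℕ} (K : Set (EuclideanSpace ℝ (Fin n))) : Prop :=
  ∃ ε > (0 : ℝ), ∀ K' : Set (EuclideanSpace ℝ (Fin n)), IsConvexBody K' →
    hausdorffDist K' K < ε → isoL n K' ≤ isoL n K

/-- `K` is a local minimizer for the isotropy constant (Hausdorff distance). -/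
def IsLocalMinIso {n : ℕ} (K : Set (EuclideanSpace ℝ (Fin n))) : Prop :=
  ∃ ε > (0 : ℝ), ∀ K' : Set (EuclideanSpace ℝ (Fin n)), IsConvexBody K' →
    hausdorffDist K' K < ε → isoL n K ≤ isoL n K'

/-- `X₀` is a point of local strict convexity of `∂K`. -/
def IsLocalStrictConvexPoint {n : ℕ} (K : Set (EuclideanSpace ℝ (Fin n)))
    (X₀ : EuclideanSpace ℝ (Fin n)) : Prop :=
  X₀ ∈ frontier K ∧
    ¬ ∃ A B : EuclideanSpace ℝ (Fin n), A ≠ B ∧ segment ℝ A B ⊆ frontier K ∧ X₀ ∈ segment ℝ A B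

/-- **Andréief's identity** for a square: the integral of a squared determinant is `n!` times
the determinant of the Gram matrix. -/
theorem integral_det_sq {n : ℕ} {α : Type*} [MeasurableSpace α] (μ : Measure α) [SigmaFinite μ]
    (f : Fin n → α → ℝ) (hf : ∀ i j, Integrable (fun x => f i x * f j x) μ) :
    ∫ X : Fin n → α, (Matrix.det (Matrix.of fun i j : Fin n => f i (X j))) ^ 2
      ∂(Measure.pi fun _ : Fin n => μ) =
      (n.factorial : ℝ) * Matrix.det (Matrix.of fun i j : Fin n => ∫ x, f i x * f j x ∂μ) := by
  have hexp : ∀ X : Fin n → α, (Matrix.det (Matrix.of fun i j : Fin n => f i (X j))) ^ 2 =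
      ∑ σ : Equiv.Perm (Fin n), ∑ τ : Equiv.Perm (Fin n),
        ((Equiv.Perm.sign σ : ℤ) : ℝ) * ((Equiv.Perm.sign τ : ℤ) : ℝ) *
          ∏ j, (f (σ j) (X j) * f (τ j) (X j)) := by
    intro X
    rw [sq, Matrix.det_apply', Finset.sum_mul_sum]
    refine Finset.sum_congr rfl fun σ _ => Finset.sum_congr rfl fun τ _ => ?_
    rw [Finset.prod_mul_distrib]
    simp only [Matrix.of_apply]
    ring
  simp_rw [hexp]
  have hint : ∀ σ τ : Equiv.Perm (Fin n), Integrable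
      (fun X : Fin n → α => ∏ j, (f (σ j) (X j) * f (τ j) (X j))) (Measure.pi fun _ => μ) :=
    fun σ τ => Integrable.fintype_prod (f := fun j x => f (σ j) x * f (τ j) x)
      fun j => hf (σ j) (τ j)
  rw [integral_finsetSum _ fun σ _ => integrable_finsetSum _ fun τ _ => (hint σ τ).const_mul _]
  have hσ : ∀ σ : Equiv.Perm (Fin n),
      ∫ X : Fin n → α, ∑ τ : Equiv.Perm (Fin n),
        ((Equiv.Perm.sign σ : ℤ) : ℝ) * ((Equiv.Perm.sign τ : ℤ) : ℝ) *
          ∏ j, (f (σ j) (X j) * f (τ j) (X j)) ∂(Measure.pi fun _ : Fin n => μ) =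
      Matrix.det (Matrix.of fun i j : Fin n => ∫ x, f i x * f j x ∂μ) := by
    intro σ
    rw [integral_finsetSum _ fun τ _ => (hint σ τ).const_mul _]
    simp_rw [integral_const_mul]
    have hprod : ∀ τ : Equiv.Perm (Fin n),
        ∫ X : Fin n → α, ∏ j, (f (σ j) (X j) * f (τ j) (X j)) ∂(Measure.pi fun _ => μ) =
        ∏ j, ∫ x, f (σ j) x * f (τ j) x ∂μ := fun τ =>
      integral_fintype_prod_eq_prod (fun j x => f (σ j) x * f (τ j) x)
    simp_rw [hprod]
    have h := Matrix.det_permute' σ (Matrix.of fun i j : Fin n => ∫ x, f i x * f j x ∂μ)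
    have hs : ((Equiv.Perm.sign σ : ℤ) : ℝ) * ((Equiv.Perm.sign σ : ℤ) : ℝ) = 1 := by
      rcases Int.units_eq_one_or (Equiv.Perm.sign σ) with h | h <;> simp [h]
    rw [Matrix.det_apply'] at h
    simp only [Matrix.submatrix_apply, Matrix.of_apply, id] at h
    simp_rw [mul_assoc, ← Finset.mul_sum]
    calc _ = ((Equiv.Perm.sign σ : ℤ) : ℝ) * (((Equiv.Perm.sign σ : ℤ) : ℝ) *
          Matrix.det (Matrix.of fun i j : Fin n => ∫ x, f i x * f j x ∂μ)) := by
          rw [← h]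
          congr 1
          refine Finset.sum_congr rfl fun τ _ => ?_
          congr 1
          refine Finset.prod_congr rfl fun j _ => ?_
          simp_rw [mul_comm]
      _ = _ := by rw [← mul_assoc, hs, one_mul]
  simp_rw [hσ]
  rw [Finset.sum_const, Finset.card_univ, Fintype.card_perm, Fintype.card_fin, nsmul_eq_mul]

/-- The map `x ↦ (1, x, x xᵀ)`, whose integral over a set collects the moments of order at most
two of that set. -/
def momentMap {n : ℕ} (x : EuclideanSpace ℝ (Fin n)) : ℝ × (Fin n → ℝ) × (Fin n → Fin n → ℝ) :=
  (1, fun i => x i, fun i j => x i * x j)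

/-- The moments of order at most two of a set. -/
def moments {n : ℕ} (K : Set (EuclideanSpace ℝ (Fin n))) :
    ℝ × (Fin n → ℝ) × (Fin n → Fin n → ℝ) :=
  ∫ x in K, momentMap x

/-- The function of the moments which gives `L_K ^ (2 n)`. -/
def isoFun {n : ℕ} (p : ℝ × (Fin n → ℝ) × (Fin n → Fin n → ℝ)) : ℝ :=
  Matrix.det (Matrix.of fun i j : Fin n => p.1 * p.2.2 i j - p.2.1 i * p.2.1 j) / p.1 ^ (2 * n + 2)

theorem continuous_momentMap {n : ℕ} : Continuous (momentMap (n := n)) := by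
  unfold momentMap
  fun_prop

theorem integrableOn_of_subset_isCompact {n : ℕ} {F : Type*} [NormedAddCommGroup F]
    {f : EuclideanSpace ℝ (Fin n) → F} (hf : Continuous f) {A S : Set (EuclideanSpace ℝ (Fin n))}
    (hS : IsCompact S) (hAS : A ⊆ S) : IntegrableOn f A :=
  (hf.continuousOn.integrableOn_compact hS).mono_set hAS

theorem moments_fst {n : ℕ} {K : Set (EuclideanSpace ℝ (Fin n))} (hK : IsCompact K) :
    (moments K).1 = (volume K).toReal := by
  have hi : IntegrableOn momentMap K :=
    integrableOn_of_subset_isCompact continuous_momentMap hK subset_rfl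
  have h := ContinuousLinearMap.integral_comp_comm
    (ContinuousLinearMap.fst ℝ ℝ ((Fin n → ℝ) × (Fin n → Fin n → ℝ))) hi
  simp only [ContinuousLinearMap.coe_fst', momentMap] at h
  rw [moments, ← show _ = (∫ x in K, momentMap x).1 from h]
  simp [Measure.real]

theorem moments_snd_fst {n : ℕ} {K : Set (EuclideanSpace ℝ (Fin n))} (hK : IsCompact K)
    (i : Fin n) : (moments K).2.1 i = ∫ x in K, x i := by
  have hi : IntegrableOn momentMap K :=
    integrableOn_of_subset_isCompact continuous_momentMap hK subset_rfl
  exact (ContinuousLinearMap.integral_comp_comm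
    ((ContinuousLinearMap.proj (R := ℝ) (φ := fun _ : Fin n => ℝ) i).comp
      ((ContinuousLinearMap.fst ℝ (Fin n → ℝ) (Fin n → Fin n → ℝ)).comp
      (ContinuousLinearMap.snd ℝ ℝ ((Fin n → ℝ) × (Fin n → Fin n → ℝ))))) hi).symm

theorem moments_snd_snd {n : ℕ} {K : Set (EuclideanSpace ℝ (Fin n))} (hK : IsCompact K)
    (i j : Fin n) : (moments K).2.2 i j = ∫ x in K, x i * x j := by
  have hi : IntegrableOn momentMap K :=
    integrableOn_of_subset_isCompact continuous_momentMap hK subset_rfl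
  exact (ContinuousLinearMap.integral_comp_comm
    ((ContinuousLinearMap.proj (R := ℝ) (φ := fun _ : Fin n => ℝ) j).comp
      ((ContinuousLinearMap.proj (R := ℝ) (φ := fun _ : Fin n => Fin n → ℝ) i).comp
      ((ContinuousLinearMap.snd ℝ (Fin n → ℝ) (Fin n → Fin n → ℝ)).comp
      (ContinuousLinearMap.snd ℝ ℝ ((Fin n → ℝ) × (Fin n → Fin n → ℝ)))))) hi).symm

theorem centroid_apply {n : ℕ} {K : Set (EuclideanSpace ℝ (Fin n))} (hK : IsCompact K)
    (i : Fin n) : centroid K i = (moments K).2.1 i / (moments K).1 := by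
  have hi : IntegrableOn (fun x : EuclideanSpace ℝ (Fin n) => x) K :=
    integrableOn_of_subset_isCompact continuous_id hK subset_rfl
  have h := ContinuousLinearMap.integral_comp_comm (EuclideanSpace.proj (𝕜 := ℝ) i) hi
  rw [moments_fst hK, moments_snd_fst hK, centroid, PiLp.smul_apply, smul_eq_mul, div_eq_inv_mul]
  congr 1
  exact h.symm

/-- The matrix of centered second moments of a set. -/
def momentMatrix {n : ℕ} (K : Set (EuclideanSpace ℝ (Fin n))) : Matrix (Fin n) (Fin n) ℝ :=
  Matrix.of fun i j => ∫ x in K, (x i - centroid K i) * (x j - centroid K j)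

theorem Mpow2n_eq_det {n : ℕ} {K : Set (EuclideanSpace ℝ (Fin n))} (hK : IsCompact K) :
    Mpow2n K = (momentMatrix K).det := by
  have hint : ∀ i j : Fin n, IntegrableOn (fun x : EuclideanSpace ℝ (Fin n) =>
      (x i - centroid K i) * (x j - centroid K j)) K := fun i j =>
    integrableOn_of_subset_isCompact (by fun_prop) hK subset_rfl
  rw [Mpow2n, detInt, Measure.restrict_pi_pi,
    integral_det_sq _ (fun i (x : EuclideanSpace ℝ (Fin n)) => x i - centroid K i) hint,
    ← mul_assoc, inv_mul_cancel₀ (by positivity), one_mul]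
  rfl

theorem momentMatrix_apply {n : ℕ} {K : Set (EuclideanSpace ℝ (Fin n))} (hK : IsCompact K)
    (h0 : (moments K).1 ≠ 0) (i j : Fin n) :
    (moments K).1 * momentMatrix K i j =
      (moments K).1 * (moments K).2.2 i j - (moments K).2.1 i * (moments K).2.1 j := by
  have hi : ∀ {f : EuclideanSpace ℝ (Fin n) → ℝ}, Continuous f → IntegrableOn f K := fun hf =>
    integrableOn_of_subset_isCompact hf hK subset_rfl
  have h : momentMatrix K i j = (moments K).2.2 i j - centroid K i * (moments K).2.1 j -
      centroid K j * (moments K).2.1 i + centroid K i * centroid K j * (moments K).1 := by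
    have hc : (moments K).1 = ∫ x : EuclideanSpace ℝ (Fin n) in K, (1 : ℝ) := by
      rw [moments_fst hK]; simp [Measure.real]
    rw [moments_snd_snd hK, moments_snd_fst hK, moments_snd_fst hK, hc, ← integral_const_mul,
      ← integral_const_mul, ← integral_const_mul, ← integral_sub (hi (by fun_prop))
      (hi (by fun_prop)), ← integral_sub (hi (by fun_prop)) (hi (by fun_prop)),
      ← integral_add (hi (by fun_prop)) (hi (by fun_prop))]
    simp only [momentMatrix, Matrix.of_apply]
    congr 1
    ext x
    ring
  rw [h, centroid_apply hK, centroid_apply hK]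
  field_simp
  ring

theorem isoFun_moments {n : ℕ} {K : Set (EuclideanSpace ℝ (Fin n))} (hK : IsCompact K)
    (h0 : (moments K).1 ≠ 0) :
    isoFun (moments K) = (momentMatrix K).det / (moments K).1 ^ (n + 2) := by
  have h : (Matrix.of fun i j : Fin n => (moments K).1 * (moments K).2.2 i j -
      (moments K).2.1 i * (moments K).2.1 j) = (moments K).1 • momentMatrix K := by
    ext i j
    rw [Matrix.smul_apply, smul_eq_mul, momentMatrix_apply hK h0, Matrix.of_apply]
  rw [isoFun, h, Matrix.det_smul, Fintype.card_fin]
  field_simp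
  ring

theorem IsConvexBody.volume_pos {n : ℕ} {K : Set (EuclideanSpace ℝ (Fin n))}
    (hK : IsConvexBody K) : 0 < (volume K).toReal :=
  ENNReal.toReal_pos (Measure.measure_pos_of_nonempty_interior _ hK.2.2).ne' hK.1.measure_lt_top.ne

theorem IsConvexBody.moments_fst_pos {n : ℕ} {K : Set (EuclideanSpace ℝ (Fin n))}
    (hK : IsConvexBody K) : 0 < (moments K).1 := by
  rw [moments_fst hK.1]
  exact hK.volume_pos

theorem IsConvexBody.isoL_eq {n : ℕ} {K : Set (EuclideanSpace ℝ (Fin n))}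
    (hK : IsConvexBody K) :
    0 ≤ isoFun (moments K) ∧ isoL n K = isoFun (moments K) ^ ((2 * (n : ℝ)))⁻¹ := by
  have hv := hK.moments_fst_pos
  have hM : 0 ≤ Mpow2n K := by
    rw [Mpow2n, detInt]
    exact mul_nonneg (by positivity) (integral_nonneg fun X => sq_nonneg _)
  rw [isoFun_moments hK.1 hv.ne', ← Mpow2n_eq_det hK.1]
  refine ⟨by positivity, ?_⟩
  rw [isoL, Real.div_rpow hM (by positivity), ← moments_fst hK.1]
  congr 1
  rw [← Real.rpow_natCast, ← Real.rpow_mul hv.le]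
  push_cast
  rfl

theorem IsConvexBody.isoL_lt_isoL {n : ℕ} (hn : 2 ≤ n) {K K' : Set (EuclideanSpace ℝ (Fin n))}
    (hK : IsConvexBody K) (hK' : IsConvexBody K')
    (h : isoFun (moments K) < isoFun (moments K')) : isoL n K < isoL n K' := by
  rw [(hK.isoL_eq).2, (hK'.isoL_eq).2]
  exact Real.rpow_lt_rpow (hK.isoL_eq).1 h (by positivity)

/-- Second order Taylor estimate at a point where `f` is `C²`. -/
theorem ContDiffAt.exists_second_order_bound {E : Type*} [NormedAddCommGroup E] [NormedSpace ℝ E]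
    {f : E → ℝ} {p : E} (hf : ContDiffAt ℝ 2 f p) :
    ∃ C ≥ (0 : ℝ), ∃ η > (0 : ℝ), ∀ u : E, ‖u‖ < η →
      |f (p + u) - f p - fderiv ℝ f p u| ≤ C * ‖u‖ ^ 2 := by
  obtain ⟨L, t, ht, hL⟩ :=
    (hf.fderiv_right (m := 1) (by norm_num)).exists_lipschitzOnWith
  have hd : ∀ᶠ x in 𝓝 p, DifferentiableAt ℝ f x := by
    filter_upwards [hf.eventually (by decide)] with x hx using hx.differentiableAt (by norm_num)
  obtain ⟨η, hη, hball⟩ := Metric.mem_nhds_iff.1 (inter_mem ht hd)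
  refine ⟨L, L.2, η, hη, fun u hu => ?_⟩
  have hsub : closedBall p ‖u‖ ⊆ ball p η := closedBall_subset_ball hu
  have h := (convex_closedBall p ‖u‖).norm_image_sub_le_of_norm_hasFDerivWithin_le'
    (f := f) (f' := fderiv ℝ f) (φ := fderiv ℝ f p) (C := L * ‖u‖) (x := p) (y := p + u)
    (fun x hx => ((hball (hsub hx)).2.hasFDerivAt).hasFDerivWithinAt)
    (fun x hx => by
      have := hL.dist_le_mul x (hball (hsub hx)).1 p (hball (mem_ball_self hη)).1
      rw [dist_eq_norm] at this
      exact this.trans (mul_le_mul_of_nonneg_left (mem_closedBall.1 hx) L.2))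
    (mem_closedBall_self (norm_nonneg _)) (by simp)
  rw [add_sub_cancel_left, Real.norm_eq_abs] at h
  rw [sq, ← mul_assoc]
  exact h

theorem IsConvexBody.momentMatrix_posDef {n : ℕ} {K : Set (EuclideanSpace ℝ (Fin n))}
    (hK : IsConvexBody K) : (momentMatrix K).PosDef := by
  refine Matrix.PosDef.of_dotProduct_mulVec_pos ?_ fun y hy => ?_
  · ext i j
    simp [momentMatrix, mul_comm]
  have hint : ∀ {f : EuclideanSpace ℝ (Fin n) → ℝ}, Continuous f → IntegrableOn f K := fun hf =>
    integrableOn_of_subset_isCompact hf hK.1 subset_rfl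
  have heq : star y ⬝ᵥ (momentMatrix K).mulVec y =
      ∫ x in K, (∑ i, y i * (x i - centroid K i)) ^ 2 := by
    have hexp : ∀ x : EuclideanSpace ℝ (Fin n), (∑ i, y i * (x i - centroid K i)) ^ 2 =
        ∑ i, ∑ j, y i * ((x i - centroid K i) * (x j - centroid K j) * y j) := by
      intro x
      rw [sq, Finset.sum_mul_sum]
      refine Finset.sum_congr rfl fun i _ => Finset.sum_congr rfl fun j _ => ?_
      ring
    simp_rw [hexp]
    rw [integral_finsetSum _ fun i _ => hint (by fun_prop)]
    refine Finset.sum_congr rfl fun i _ => ?_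
    rw [integral_finsetSum _ fun j _ => hint (by fun_prop), Matrix.mulVec, dotProduct,
      Finset.mul_sum]
    refine Finset.sum_congr rfl fun j _ => ?_
    rw [integral_const_mul, integral_mul_const]
    rfl
  rw [heq, setIntegral_pos_iff_support_of_nonneg_ae (ae_of_all _ fun x => sq_nonneg _)
    (hint (by fun_prop))]
  set f : EuclideanSpace ℝ (Fin n) → ℝ := fun x => (∑ i, y i * (x i - centroid K i)) ^ 2 with hf
  have hfc : Continuous f := by fun_prop
  have hopen : IsOpen (Function.support f ∩ interior K) :=
    (isOpen_ne.preimage hfc).inter isOpen_interior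
  refine (hopen.measure_pos volume ?_).trans_le
    (measure_mono (inter_subset_inter_right _ interior_subset))
  by_contra hne
  obtain ⟨x₀, hx₀⟩ := hK.2.2
  have hzero : ∀ x ∈ interior K, ∑ i, y i * (x i - centroid K i) = 0 := by
    intro x hx
    by_contra h
    exact hne ⟨x, by simpa [hf, Function.mem_support] using h, hx⟩
  have hcont : Tendsto (fun t : ℝ => x₀ + t • WithLp.toLp 2 y) (𝓝[>] 0) (𝓝 x₀) := by
    have : Tendsto (fun t : ℝ => x₀ + t • WithLp.toLp 2 y) (𝓝 0)
        (𝓝 (x₀ + (0 : ℝ) • WithLp.toLp 2 y)) :=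
      Continuous.tendsto (by fun_prop) 0
    rw [zero_smul, add_zero] at this
    exact this.mono_left nhdsWithin_le_nhds
  obtain ⟨t, ht, htpos⟩ := ((hcont.eventually (isOpen_interior.mem_nhds hx₀)).and
    self_mem_nhdsWithin).exists
  have h1 := hzero _ ht
  have h0 := hzero _ hx₀
  have h2 : t * ∑ i, y i * y i = 0 := by
    rw [← sub_eq_zero_of_eq (h1.trans h0.symm), ← Finset.sum_sub_distrib, Finset.mul_sum]
    refine Finset.sum_congr rfl fun i _ => ?_
    simp only [PiLp.add_apply, PiLp.smul_apply, smul_eq_mul]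
    ring
  have h3 : ∑ i, y i * y i = 0 := (mul_eq_zero.1 h2).resolve_left (ne_of_gt htpos)
  exact hy (dotProduct_self_eq_zero.1 h3)

theorem contDiffAt_isoFun {n : ℕ} {p : ℝ × (Fin n → ℝ) × (Fin n → Fin n → ℝ)} (hp : p.1 ≠ 0) :
    ContDiffAt ℝ 2 isoFun p := by
  unfold isoFun
  refine ContDiffAt.div ?_ (by fun_prop) (pow_ne_zero _ hp)
  simp only [Matrix.det_apply', Matrix.of_apply]
  fun_prop

theorem Matrix.det_add_smul_vecMulVec {m : Type*} [Fintype m] [DecidableEq m]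
    {A : Matrix m m ℝ} (hA : IsUnit A.det) (r : ℝ) (v : m → ℝ) :
    (A + r • Matrix.vecMulVec v v).det = A.det * (1 + r * (v ⬝ᵥ A⁻¹.mulVec v)) := by
  have h := Matrix.det_add_replicateCol_mul_replicateRow (ι := Unit) hA (r • v) v
  rw [← Matrix.vecMulVec_eq, Matrix.smul_vecMulVec] at h
  rw [h]
  congr 1
  rw [Matrix.det_unique, Matrix.add_apply, Matrix.one_apply_eq, Matrix.mul_assoc,
    Matrix.mul_apply_eq_vecMul]
  congr 1
  simp only [Matrix.vecMul, dotProduct, Matrix.replicateRow_apply, Matrix.mul_apply, Matrix.mulVec,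
    Matrix.replicateCol_apply, Pi.smul_apply, smul_eq_mul, Finset.mul_sum]
  refine Finset.sum_congr rfl fun i _ => Finset.sum_congr rfl fun j _ => ?_
  ring

theorem IsConvexBody.isoFun_add_smul {n : ℕ} {K : Set (EuclideanSpace ℝ (Fin n))}
    (hK : IsConvexBody K) (x : EuclideanSpace ℝ (Fin n)) {t : ℝ} (ht : (moments K).1 + t ≠ 0) :
    isoFun (moments K + t • momentMap x) = (momentMatrix K).det *
      (1 + t * (moments K).1 / ((moments K).1 + t) *
        ((x - centroid K).ofLp ⬝ᵥ (momentMatrix K)⁻¹.mulVec (x - centroid K).ofLp)) /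
      ((moments K).1 + t) ^ (n + 2) := by
  have h0 := hK.moments_fst_pos.ne'
  have hA : IsUnit (momentMatrix K).det := hK.momentMatrix_posDef.det_pos.ne'.isUnit
  have h : (Matrix.of fun i j : Fin n => (moments K + t • momentMap x).1 *
      (moments K + t • momentMap x).2.2 i j -
      (moments K + t • momentMap x).2.1 i * (moments K + t • momentMap x).2.1 j) =
      ((moments K).1 + t) • (momentMatrix K + (t * (moments K).1 / ((moments K).1 + t)) •
        Matrix.vecMulVec (x - centroid K).ofLp (x - centroid K).ofLp) := by
    ext i j
    have hm := momentMatrix_apply hK.1 h0 i j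
    have hc := centroid_apply hK.1 i
    have hc' := centroid_apply hK.1 j
    simp only [Matrix.smul_apply, smul_eq_mul, Matrix.of_apply, momentMap, Matrix.add_apply,
      Matrix.vecMulVec_apply, Prod.fst_add, Prod.snd_add, Prod.smul_fst, Prod.smul_snd,
      Pi.add_apply, Pi.smul_apply, PiLp.sub_apply, hc, hc', mul_one]
    have hm' : momentMatrix K i j =
      (moments K).2.2 i j - (moments K).2.1 i * (moments K).2.1 j / (moments K).1 := by
      field_simp
      linarith
    rw [hm']
    field_simp
    ring
  have h1 : (moments K + t • momentMap x).1 = (moments K).1 + t := by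
    simp [momentMap]
  rw [isoFun, h, h1, Matrix.det_smul, Fintype.card_fin, Matrix.det_add_smul_vecMulVec hA]
  field_simp
  ring

theorem IsConvexBody.fderiv_isoFun {n : ℕ} {K : Set (EuclideanSpace ℝ (Fin n))}
    (hK : IsConvexBody K) (x : EuclideanSpace ℝ (Fin n)) :
    fderiv ℝ isoFun (moments K) (momentMap x) =
      (momentMatrix K).det / (moments K).1 ^ (n + 2) *
        ((x - centroid K).ofLp ⬝ᵥ (momentMatrix K)⁻¹.mulVec (x - centroid K).ofLp) -
      (n + 2) * (momentMatrix K).det / (moments K).1 ^ (n + 3) := by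
  have h0 := hK.moments_fst_pos.ne'
  set Q := (x - centroid K).ofLp ⬝ᵥ (momentMatrix K)⁻¹.mulVec (x - centroid K).ofLp
  set m := (moments K).1
  set a := (momentMatrix K).det
  have hd : HasFDerivAt isoFun (fderiv ℝ isoFun (moments K)) (moments K) :=
    ((contDiffAt_isoFun h0).differentiableAt (by norm_num)).hasFDerivAt
  have h1 : HasDerivAt (fun t : ℝ => isoFun (moments K + t • momentMap x))
      (fderiv ℝ isoFun (moments K) (momentMap x)) 0 := by
    have hl : HasDerivAt (fun t : ℝ => moments K + t • momentMap x) (momentMap x) 0 := by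
      simpa using ((hasDerivAt_id (0 : ℝ)).smul_const (momentMap x)).const_add (moments K)
    have hd' : HasFDerivAt isoFun (fderiv ℝ isoFun (moments K))
        (moments K + (0 : ℝ) • momentMap x) := by simpa using hd
    exact hd'.comp_hasDerivAt (0 : ℝ) hl
  have hm : HasDerivAt (fun t : ℝ => m + t) 1 0 := (hasDerivAt_id (0 : ℝ)).const_add m
  have h2 : HasDerivAt (fun t : ℝ => a * (1 + t * m / (m + t) * Q) / (m + t) ^ (n + 2))
      (a / m ^ (n + 2) * Q - (n + 2) * a / m ^ (n + 3)) 0 := by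
    have h3 := ((((((hasDerivAt_id (0 : ℝ)).mul_const m).div hm (by simpa using h0)).mul_const
      Q).const_add 1).const_mul a).div (hm.pow (n + 2)) (by simpa using h0)
    refine HasDerivAt.congr_deriv h3 ?_
    simp only [id, zero_mul, add_zero, Pi.div_apply, Pi.pow_apply, one_mul, mul_one, zero_div,
      sub_zero, show n + 2 - 1 = n + 1 from rfl]
    push_cast
    field_simp
    ring
  refine h1.unique (h2.congr_of_eventuallyEq ?_)
  have hne : ∀ᶠ t : ℝ in 𝓝 0, m + t ≠ 0 :=
    (by fun_prop : Continuous fun t : ℝ => m + t).continuousAt.eventually_ne (by simpa using h0)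
  filter_upwards [hne] with t ht
  exact hK.isoFun_add_smul x ht

/-- First variation, with quadratic error, of `L_K ^ (2 n)` under adding or removing a set of
small volume. -/
theorem IsConvexBody.exists_first_variation {n : ℕ} {K : Set (EuclideanSpace ℝ (Fin n))}
    (hK : IsConvexBody K) :
    ∃ (B : EuclideanSpace ℝ (Fin n) →L[ℝ] EuclideanSpace ℝ (Fin n))
      (g : EuclideanSpace ℝ (Fin n)) (c : ℝ),
      (∀ x y, ⟪B x, y⟫_ℝ = ⟪x, B y⟫_ℝ) ∧ (∀ x, x ≠ 0 → 0 < ⟪x, B x⟫_ℝ) ∧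
      ∀ S : Set (EuclideanSpace ℝ (Fin n)), IsCompact S → ∃ C ≥ (0 : ℝ), ∃ η > (0 : ℝ),
        ∀ D ⊆ S, (volume D).toReal < η → ∀ σ : ℝ, |σ| = 1 →
          |isoFun (moments K + σ • moments D) - isoFun (moments K) -
            σ * ∫ x in D, (⟪x - g, B (x - g)⟫_ℝ - c)| ≤ C * (volume D).toReal ^ 2 := by
  have h0 := hK.moments_fst_pos
  have hpd := hK.momentMatrix_posDef
  set a := (momentMatrix K).det / (moments K).1 ^ (n + 2) with ha
  have hapos : 0 < a := div_pos hpd.det_pos (by positivity)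
  have hB := hpd.inv.smul hapos
  refine ⟨Matrix.toEuclideanCLM (𝕜 := ℝ) (a • (momentMatrix K)⁻¹), centroid K,
    (n + 2) * (momentMatrix K).det / (moments K).1 ^ (n + 3), fun x y => ?_, fun x hx => ?_,
    fun S hS => ?_⟩
  · rw [real_inner_comm, Matrix.inner_toEuclideanCLM, Matrix.inner_toEuclideanCLM,
      Matrix.dotProduct_mulVec, ← Matrix.mulVec_transpose, dotProduct_comm]
    have := hB.isHermitian.eq
    rw [Matrix.conjTranspose_eq_transpose_of_trivial] at this
    rw [this]
  · rw [Matrix.inner_toEuclideanCLM]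
    exact hB.dotProduct_mulVec_pos (x := x.ofLp) fun h => hx (by ext i; simpa using congrFun h i)
  obtain ⟨C, hC, η, hη, hT⟩ := (contDiffAt_isoFun h0.ne').exists_second_order_bound
  obtain ⟨R, hR⟩ := hS.exists_bound_of_continuousOn continuous_momentMap.continuousOn
  have hR' : ∀ x ∈ S, ‖momentMap x‖ ≤ |R| + 1 := fun x hx =>
    (hR x hx).trans ((le_abs_self R).trans (by linarith))
  have hRpos : 0 < |R| + 1 := by positivity
  refine ⟨C * (|R| + 1) ^ 2, by positivity, η / (|R| + 1), by positivity,
    fun D hD hDv σ hσ => ?_⟩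
  have hfin : volume D < ⊤ := (measure_mono hD).trans_lt hS.measure_lt_top
  have hi : IntegrableOn momentMap D :=
    integrableOn_of_subset_isCompact continuous_momentMap hS hD
  have hnorm : ‖moments D‖ ≤ (|R| + 1) * (volume D).toReal :=
    norm_setIntegral_le_of_norm_le_const hfin fun x hx => hR' x (hD hx)
  have hnorm' : ‖σ • moments D‖ ≤ (|R| + 1) * (volume D).toReal := by
    rw [norm_smul, Real.norm_eq_abs, hσ, one_mul]
    exact hnorm
  have hlt : ‖σ • moments D‖ < η := by
    refine hnorm'.trans_lt ?_
    rwa [lt_div_iff₀ hRpos, mul_comm] at hDv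
  have hder : fderiv ℝ isoFun (moments K) (σ • moments D) = σ * ∫ x in D,
      (⟪x - centroid K, Matrix.toEuclideanCLM (𝕜 := ℝ) (a • (momentMatrix K)⁻¹)
        (x - centroid K)⟫_ℝ - (n + 2) * (momentMatrix K).det / (moments K).1 ^ (n + 3)) := by
    rw [map_smul, smul_eq_mul, moments.eq_1 D, ← ContinuousLinearMap.integral_comp_comm _ hi]
    congr 2
    ext x
    rw [hK.fderiv_isoFun, Matrix.inner_toEuclideanCLM, Matrix.smul_mulVec, dotProduct_smul,
      smul_eq_mul]
  rw [← hder]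
  refine (hT _ hlt).trans ?_
  rw [mul_assoc, ← mul_pow]
  gcongr

theorem QuadraticForm.continuous_of_finiteDimensional {n : ℕ}
    (Q : QuadraticForm ℝ (EuclideanSpace ℝ (Fin n))) : Continuous Q := by
  have h : ∀ v, Q v = (1 / 2 : ℝ) * LinearMap.toContinuousLinearMap
      (LinearMap.toContinuousLinearMap.toLinearMap.comp Q.polarBilin) v v := by
    intro v
    simp [QuadraticMap.polar_self]
  rw [funext h]
  fun_prop

theorem exists_mem_frontier_of_segment {n : ℕ} {K : Set (EuclideanSpace ℝ (Fin n))}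
    {x y : EuclideanSpace ℝ (Fin n)} (hx : x ∈ K) (hy : y ∉ K) :
    ∃ z ∈ segment ℝ x y, z ∈ frontier K := by
  by_contra! h
  have hp : IsPreconnected (segment ℝ x y) := (convex_segment x y).isPreconnected
  obtain ⟨z, hz⟩ := hp (interior K) (closure K)ᶜ isOpen_interior isClosed_closure.isOpen_compl
    (fun z hz => by
      by_contra hn
      rw [mem_union, not_or, mem_compl_iff, not_not] at hn
      exact h z hz ⟨hn.2, hn.1⟩)
    ⟨x, left_mem_segment ℝ x y, by
      by_contra hn
      exact h x (left_mem_segment ℝ x y) ⟨subset_closure hx, hn⟩⟩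
    ⟨y, right_mem_segment ℝ x y, fun hc =>
      h y (right_mem_segment ℝ x y) ⟨hc, fun hi => hy (interior_subset hi)⟩⟩
  exact hz.2.2 (interior_subset_closure hz.2.1)

/-- Near the point `X₀`, the boundary of `K` is squeezed between the paraboloids
`⟪x - X₀, N⟫ = (1 ± ε) Q (x - X₀)`, where `Q` does not depend on the `N` component. -/
structure IsParaboloidal {n : ℕ} (K : Set (EuclideanSpace ℝ (Fin n)))
    (X₀ N : EuclideanSpace ℝ (Fin n)) (Q : QuadraticForm ℝ (EuclideanSpace ℝ (Fin n))) : Prop where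
  norm_eq : ‖N‖ = 1
  support : ∀ x ∈ K, 0 ≤ ⟪x - X₀, N⟫_ℝ
  map_add_smul : ∀ v (r : ℝ), Q (v + r • N) = Q v
  pos : ∀ v, ⟪v, N⟫_ℝ = 0 → v ≠ 0 → 0 < Q v
  sandwich : ∀ ε > (0 : ℝ), ∃ a > (0 : ℝ), ∀ x ∈ ball X₀ a,
    ((1 + ε) * Q (x - X₀) < ⟪x - X₀, N⟫_ℝ → x ∈ K) ∧
    (x ∈ K → (1 - ε) * Q (x - X₀) ≤ ⟪x - X₀, N⟫_ℝ)

theorem inner_sub_smul_self {n : ℕ} {N : EuclideanSpace ℝ (Fin n)} (hN : ‖N‖ = 1)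
    (v : EuclideanSpace ℝ (Fin n)) : ⟪v - ⟪v, N⟫_ℝ • N, N⟫_ℝ = 0 := by
  rw [inner_sub_left, real_inner_smul_left, real_inner_self_eq_norm_sq, hN]
  ring

theorem quadraticForm_nonneg {n : ℕ} {N : EuclideanSpace ℝ (Fin n)}
    {Q : QuadraticForm ℝ (EuclideanSpace ℝ (Fin n))} (hN : ‖N‖ = 1)
    (hQ : ∀ v (r : ℝ), Q (v + r • N) = Q v) (hpos : ∀ v, ⟪v, N⟫_ℝ = 0 → v ≠ 0 → 0 < Q v)
    (v : EuclideanSpace ℝ (Fin n)) : 0 ≤ Q v := by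
  have h : Q (v - ⟪v, N⟫_ℝ • N) = Q v := by
    rw [← hQ (v - ⟪v, N⟫_ℝ • N) ⟪v, N⟫_ℝ, sub_add_cancel]
  rw [← h]
  rcases eq_or_ne (v - ⟪v, N⟫_ℝ • N) 0 with h0 | h0
  · rw [h0, QuadraticMap.map_zero]
  · exact (hpos _ (inner_sub_smul_self hN v) h0).le

theorem quadraticForm_convexCombo_le {n : ℕ} {Q : QuadraticForm ℝ (EuclideanSpace ℝ (Fin n))}
    (hQ : ∀ v, 0 ≤ Q v) (u v : EuclideanSpace ℝ (Fin n)) {a b : ℝ} (ha : 0 ≤ a) (hb : 0 ≤ b)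
    (hab : a + b = 1) : Q (a • u + b • v) ≤ a * Q u + b * Q v := by
  have h1 := QuadraticMap.map_add Q (a • u) (b • v)
  have h2 : Q (u - v) = Q u + Q v - QuadraticMap.polar Q u v := by
    rw [sub_eq_add_neg, QuadraticMap.map_add Q u (-v), QuadraticMap.polar_neg_right,
      QuadraticMap.map_neg]
    ring
  rw [QuadraticMap.map_smul, QuadraticMap.map_smul, QuadraticMap.polar_smul_left,
    QuadraticMap.polar_smul_right] at h1
  simp only [smul_eq_mul] at h1
  have h3 := hQ (u - v)
  have h4 : 0 ≤ a * b * Q (u - v) := by positivity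
  rw [h1]
  obtain rfl : a = 1 - b := by linarith
  rw [h2] at h4
  nlinarith

theorem inner_sub_pos_of_mem_interior {n : ℕ} {K : Set (EuclideanSpace ℝ (Fin n))}
    {X₀ N c : EuclideanSpace ℝ (Fin n)} (hN : ‖N‖ = 1) (hsupp : ∀ x ∈ K, 0 ≤ ⟪x - X₀, N⟫_ℝ)
    (hc : c ∈ interior K) : 0 < ⟪c - X₀, N⟫_ℝ := by
  have ht : Tendsto (fun t : ℝ => c - t • N) (𝓝[>] 0) (𝓝 c) := by
    have : Tendsto (fun t : ℝ => c - t • N) (𝓝 0) (𝓝 (c - (0 : ℝ) • N)) :=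
      Continuous.tendsto (by fun_prop) 0
    rw [zero_smul, sub_zero] at this
    exact this.mono_left nhdsWithin_le_nhds
  obtain ⟨t, ht, htpos⟩ := ((ht.eventually (isOpen_interior.mem_nhds hc)).and
    self_mem_nhdsWithin).exists
  have h1 := hsupp _ (interior_subset ht)
  rw [sub_right_comm, inner_sub_left, real_inner_smul_left, real_inner_self_eq_norm_sq, hN] at h1
  have h2 : 0 < t := htpos
  linarith

theorem isParaboloidal_of_curvWitness {n : ℕ} {K : Set (EuclideanSpace ℝ (Fin n))}
    (hK : IsConvexBody K) {X₀ N : EuclideanSpace ℝ (Fin n)} (hX₀ : X₀ ∈ frontier K)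
    {q : QuadraticForm ℝ (EuclideanSpace ℝ (Fin n))} (h : CurvWitness K X₀ N q) :
    ∃ Q, IsParaboloidal K X₀ N Q := by
  obtain ⟨hN, hsupp, hq, hcurv⟩ := h
  let P : EuclideanSpace ℝ (Fin n) →ₗ[ℝ] EuclideanSpace ℝ (Fin n) :=
    LinearMap.id - (LinearMap.toSpanSingleton ℝ _ N).comp (innerₗ _ N)
  have hP : ∀ v, P v = v - ⟪v, N⟫_ℝ • N := fun v => by simp [P, real_inner_comm]
  have hNN : ⟪N, N⟫_ℝ = 1 := by rw [real_inner_self_eq_norm_sq, hN]; norm_num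
  have hPN : ∀ v, ⟪P v, N⟫_ℝ = 0 := fun v => by rw [hP, inner_sub_smul_self hN]
  set Q : QuadraticForm ℝ (EuclideanSpace ℝ (Fin n)) := q.comp P with hQdef
  have hQ : ∀ v, Q v = q (P v) := fun v => QuadraticMap.comp_apply _ _ _
  have hQN : ∀ v (r : ℝ), Q (v + r • N) = Q v := by
    intro v r
    rw [hQ, hQ]
    congr 1
    rw [hP, hP, inner_add_left, real_inner_smul_left, hNN]
    module
  have hQpos : ∀ v, ⟪v, N⟫_ℝ = 0 → v ≠ 0 → 0 < Q v := by
    intro v hv h0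
    rw [hQ, hP, hv, zero_smul, sub_zero]
    exact hq v hv h0
  have hQ0 := quadraticForm_nonneg hN hQN hQpos
  have hcl : IsClosed K := hK.1.isClosed
  have hfr : frontier K ⊆ K := hcl.frontier_subset
  have hcurv' : ∀ ε > (0 : ℝ), ∃ a > (0 : ℝ), ∀ x ∈ ball X₀ a, x ∈ frontier K →
      (1 - ε) * Q (x - X₀) ≤ ⟪x - X₀, N⟫_ℝ ∧ ⟪x - X₀, N⟫_ℝ ≤ (1 + ε) * Q (x - X₀) := by
    intro ε hε
    obtain ⟨a, ha, h⟩ := hcurv ε hε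
    refine ⟨a, ha, fun x hx hxf => ?_⟩
    rw [hQ]
    refine h (P (x - X₀)) ⟪x - X₀, N⟫_ℝ (hPN _) ?_
    have : X₀ + P (x - X₀) + ⟪x - X₀, N⟫_ℝ • N = x := by rw [hP]; abel
    rw [this]
    exact ⟨hxf, hx⟩
  refine ⟨Q, hN, hsupp, hQN, hQpos, fun ε hε => ?_⟩
  obtain ⟨a, ha, hfront⟩ := hcurv' ε hε
  refine ⟨a, ha, fun x hx => ⟨fun hlt => ?_, fun hxK => ?_⟩⟩
  · by_contra hxK
    obtain ⟨c, hc⟩ := hK.2.2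
    have hcK := interior_subset hc
    set w := c - X₀ with hw
    have hyc : 0 < ⟪w, N⟫_ℝ := inner_sub_pos_of_mem_interior hN hsupp hc
    have hev : ∀ᶠ t : ℝ in 𝓝[>] 0, X₀ + t • w ∈ ball X₀ a ∧ t * ((1 + ε) * Q w) < ⟪w, N⟫_ℝ ∧
        t < 1 := by
      refine Filter.Eventually.filter_mono nhdsWithin_le_nhds ?_
      refine (Continuous.tendsto' (by fun_prop) (0 : ℝ) X₀ (by simp)
        |>.eventually (ball_mem_nhds X₀ ha)).and (Filter.Eventually.and ?_
          (eventually_lt_nhds one_pos))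
      exact (Continuous.tendsto' (by fun_prop) (0 : ℝ) (0 : ℝ) (by simp)).eventually
        (eventually_lt_nhds hyc)
    obtain ⟨t, ⟨htb, htlt, ht1⟩, htpos⟩ := (hev.and self_mem_nhdsWithin).exists
    have ht0 : 0 < t := htpos
    have hX₀K : X₀ ∈ K := hfr hX₀
    have hct : X₀ + t • w ∈ K := by
      have := hK.2.1 hX₀K hcK (by linarith : 0 ≤ 1 - t) ht0.le (by ring)
      convert this using 1
      rw [hw]
      module
    obtain ⟨z, ⟨α, β, hα, hβ, hαβ, rfl⟩, hz⟩ := exists_mem_frontier_of_segment hct hxK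
    have hzb := convex_ball X₀ a htb hx hα hβ hαβ
    have h1 := (hfront _ hzb hz).2
    have h2 : α • (X₀ + t • w) + β • x - X₀ = α • (t • w) + β • (x - X₀) := by
      obtain rfl : α = 1 - β := by linarith
      module
    rw [h2, inner_add_left, real_inner_smul_left, real_inner_smul_left, real_inner_smul_left] at h1
    have h3 := quadraticForm_convexCombo_le hQ0 (t • w) (x - X₀) hα hβ hαβ
    rw [QuadraticMap.map_smul, smul_eq_mul] at h3
    have h4 : t * (t * ((1 + ε) * Q w)) < t * ⟪w, N⟫_ℝ := mul_lt_mul_of_pos_left htlt ht0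
    have h5 : (1 + ε) * Q (α • (t • w) + β • (x - X₀)) ≤
        (1 + ε) * (α * (t * t * Q w) + β * Q (x - X₀)) :=
      mul_le_mul_of_nonneg_left h3 (by linarith)
    rcases hα.eq_or_lt with rfl | hα0
    · obtain rfl : β = 1 := by linarith
      linarith
    · have h6 := mul_lt_mul_of_pos_left h4 hα0
      have h7 := mul_le_mul_of_nonneg_left hlt.le hβ
      linarith
  · have hy0 := hsupp x hxK
    set y := ⟪x - X₀, N⟫_ℝ with hy
    have hout : X₀ + P (x - X₀) + (-1 : ℝ) • N ∉ K := by
      intro hmem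
      have := hsupp _ hmem
      rw [add_assoc, add_sub_cancel_left, inner_add_left, hPN, real_inner_smul_left, hNN] at this
      linarith
    obtain ⟨z, ⟨α, β, hα, hβ, hαβ, rfl⟩, hz⟩ := exists_mem_frontier_of_segment hxK hout
    have hxe : x = X₀ + P (x - X₀) + y • N := by rw [hP]; abel
    have hze : α • x + β • (X₀ + P (x - X₀) + (-1 : ℝ) • N) =
        X₀ + P (x - X₀) + (α * y - β) • N := by
      nth_rewrite 1 [hxe]
      obtain rfl : α = 1 - β := by linarith
      module
    rw [hze] at hz
    have hy' := hsupp _ (hfr hz)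
    rw [add_assoc, add_sub_cancel_left, inner_add_left, hPN, real_inner_smul_left, hNN] at hy'
    have hle : α * y - β ≤ y := by nlinarith
    have hn : ∀ r : ℝ, ‖P (x - X₀) + r • N‖ ^ 2 = ‖P (x - X₀)‖ ^ 2 + r ^ 2 := by
      intro r
      rw [norm_add_sq_real, real_inner_smul_right, hPN, norm_smul, hN]
      simp
    have hzb : X₀ + P (x - X₀) + (α * y - β) • N ∈ ball X₀ a := by
      rw [mem_ball, dist_eq_norm, add_assoc, add_sub_cancel_left]
      rw [mem_ball, dist_eq_norm] at hx
      refine lt_of_le_of_lt ?_ hx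
      have h1 : x - X₀ = P (x - X₀) + y • N := by rw [hP]; abel
      have h2 := hn y
      rw [← h1] at h2
      refine (sq_le_sq₀ (norm_nonneg _) (norm_nonneg _)).1 ?_
      rw [hn, h2]
      gcongr
      linarith
    have h1 := (hfront _ hzb hz).1
    rw [add_assoc, add_sub_cancel_left, inner_add_left, hPN, real_inner_smul_left, hNN, hQN] at h1
    have h2 : Q (P (x - X₀)) = Q (x - X₀) := by
      rw [← hQN (P (x - X₀)) ⟪x - X₀, N⟫_ℝ, hP, sub_add_cancel]
    rw [h2] at h1
    linarith

/-- The affine change of coordinates adapted to the paraboloid `⟪x - X₀, N⟫ = Q (x - X₀)` near its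
point at horizontal displacement `s • Y₀`, with horizontal scale `s` and vertical scale `s ^ 2`. -/
def paraMap {n : ℕ} (X₀ N : EuclideanSpace ℝ (Fin n))
    (Q : QuadraticForm ℝ (EuclideanSpace ℝ (Fin n))) (Y₀ : EuclideanSpace ℝ (Fin n)) (s : ℝ)
    (v : EuclideanSpace ℝ (Fin n)) : EuclideanSpace ℝ (Fin n) :=
  X₀ + s • (Y₀ + v - ⟪v, N⟫_ℝ • N) +
    (s ^ 2 * (⟪v, N⟫_ℝ + Q Y₀ + QuadraticMap.polar Q Y₀ v)) • N

section paraMap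

variable {n : ℕ} {K : Set (EuclideanSpace ℝ (Fin n))} {X₀ N Y₀ : EuclideanSpace ℝ (Fin n)}
  {Q : QuadraticForm ℝ (EuclideanSpace ℝ (Fin n))}

theorem IsParaboloidal.inner_self (h : IsParaboloidal K X₀ N Q) : ⟪N, N⟫_ℝ = 1 := by
  rw [real_inner_self_eq_norm_sq, h.norm_eq, one_pow]

theorem IsParaboloidal.polar_add_smul (h : IsParaboloidal K X₀ N Q)
    (u v : EuclideanSpace ℝ (Fin n)) (r : ℝ) :
    QuadraticMap.polar Q u (v + r • N) = QuadraticMap.polar Q u v := by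
  rw [QuadraticMap.polar, QuadraticMap.polar, ← add_assoc, h.map_add_smul, h.map_add_smul]

theorem IsParaboloidal.polar_normal (h : IsParaboloidal K X₀ N Q)
    (u : EuclideanSpace ℝ (Fin n)) : QuadraticMap.polar Q u N = 0 := by
  have := h.polar_add_smul u 0 1
  rwa [zero_add, one_smul, QuadraticMap.polar_zero_right] at this

theorem IsParaboloidal.nonneg (h : IsParaboloidal K X₀ N Q) (v : EuclideanSpace ℝ (Fin n)) :
    0 ≤ Q v :=
  quadraticForm_nonneg h.norm_eq h.map_add_smul h.pos v

theorem paraMap_zero (v : EuclideanSpace ℝ (Fin n)) : paraMap X₀ N Q Y₀ 0 v = X₀ := by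
  simp [paraMap]

theorem continuous_uncurry_paraMap :
    Continuous (fun p : ℝ × EuclideanSpace ℝ (Fin n) => paraMap X₀ N Q Y₀ p.1 p.2) := by
  have := Q.continuous_of_finiteDimensional
  unfold paraMap QuadraticMap.polar
  fun_prop

theorem IsParaboloidal.inner_paraMap_sub (h : IsParaboloidal K X₀ N Q) (hY₀ : ⟪Y₀, N⟫_ℝ = 0)
    (s : ℝ) (v : EuclideanSpace ℝ (Fin n)) :
    ⟪paraMap X₀ N Q Y₀ s v - X₀, N⟫_ℝ =
      s ^ 2 * (⟪v, N⟫_ℝ + Q Y₀ + QuadraticMap.polar Q Y₀ v) := by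
  rw [paraMap, add_assoc, add_sub_cancel_left, inner_add_left, real_inner_smul_left,
    real_inner_smul_left, h.inner_self, add_sub_assoc, inner_add_left,
    inner_sub_smul_self h.norm_eq, hY₀]
  ring

theorem IsParaboloidal.map_paraMap_sub (h : IsParaboloidal K X₀ N Q)
    (s : ℝ) (v : EuclideanSpace ℝ (Fin n)) :
    Q (paraMap X₀ N Q Y₀ s v - X₀) = s ^ 2 * (Q v + Q Y₀ + QuadraticMap.polar Q Y₀ v) := by
  rw [paraMap, add_assoc, add_sub_cancel_left, h.map_add_smul, QuadraticMap.map_smul,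
    sub_eq_add_neg, ← neg_smul, h.map_add_smul, QuadraticMap.map_add Q Y₀ v, smul_eq_mul]
  ring

theorem paraMap_convexCombo (s : ℝ) (v w : EuclideanSpace ℝ (Fin n)) {a b : ℝ} (hab : a + b = 1) :
    paraMap X₀ N Q Y₀ s (a • v + b • w) =
      a • paraMap X₀ N Q Y₀ s v + b • paraMap X₀ N Q Y₀ s w := by
  obtain rfl : a = 1 - b := by linarith
  simp only [paraMap, inner_add_left, real_inner_smul_left, QuadraticMap.polar_add_right,
    QuadraticMap.polar_smul_right, smul_eq_mul]
  module

theorem convex_preimage_paraMap {C : Set (EuclideanSpace ℝ (Fin n))} (hC : Convex ℝ C) (s : ℝ) :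
    Convex ℝ (paraMap X₀ N Q Y₀ s ⁻¹' C) := by
  intro v hv w hw a b ha hb hab
  rw [mem_preimage, paraMap_convexCombo s v w hab]
  exact hC hv hw ha hb hab

theorem IsParaboloidal.surjective_paraMap (h : IsParaboloidal K X₀ N Q) (hY₀ : ⟪Y₀, N⟫_ℝ = 0)
    {s : ℝ} (hs : 0 < s) : Function.Surjective (paraMap X₀ N Q Y₀ s) := by
  intro x
  set y := ⟪x - X₀, N⟫_ℝ with hy
  set u := s⁻¹ • (x - X₀ - y • N) - Y₀ with hu
  have huN : ⟪u, N⟫_ℝ = 0 := by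
    rw [hu, inner_sub_left, real_inner_smul_left, inner_sub_smul_self h.norm_eq, hY₀]
    ring
  refine ⟨u + (y / s ^ 2 - Q Y₀ - QuadraticMap.polar Q Y₀ u) • N, ?_⟩
  have hcancel : y / s ^ 2 - Q Y₀ - QuadraticMap.polar Q Y₀ u + Q Y₀ + QuadraticMap.polar Q Y₀ u =
      y / s ^ 2 := by ring
  rw [paraMap, h.polar_add_smul, inner_add_left, real_inner_smul_left, huN, h.inner_self, zero_add,
    mul_one, add_sub_assoc, add_sub_cancel_right, hcancel,
    mul_div_cancel₀ _ (by positivity), hu, add_sub_cancel, smul_inv_smul₀ hs.ne']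
  abel

theorem IsParaboloidal.volume_image_paraMap (h : IsParaboloidal K X₀ N Q)
    {s : ℝ} (hs : 0 < s) (A : Set (EuclideanSpace ℝ (Fin n))) :
    volume (paraMap X₀ N Q Y₀ s '' A) = ENNReal.ofReal (s ^ (n + 1)) * volume A := by
  let f : EuclideanSpace ℝ (Fin n) →ₗ[ℝ] ℝ :=
    (s - 1) • (innerₗ _ N) + s • Q.polarBilin Y₀
  have hf : ∀ v, f v = (s - 1) * ⟪v, N⟫_ℝ + s * QuadraticMap.polar Q Y₀ v := fun v => by
    simp [f, real_inner_comm]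
  let T : EuclideanSpace ℝ (Fin n) →ₗ[ℝ] EuclideanSpace ℝ (Fin n) := s • LinearMap.transvection f N
  have hT : ∀ v, paraMap X₀ N Q Y₀ s v = (X₀ + s • Y₀ + (s ^ 2 * Q Y₀) • N) + T v := by
    intro v
    simp only [T, LinearMap.smul_apply, LinearMap.transvection.apply, hf, paraMap]
    module
  have himage : paraMap X₀ N Q Y₀ s '' A =
      (fun w => (X₀ + s • Y₀ + (s ^ 2 * Q Y₀) • N) + w) '' (T '' A) := by
    rw [image_image]
    exact image_congr fun v _ => hT v
  have hdet : LinearMap.det T = s ^ (n + 1) := by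
    simp only [T]
    rw [LinearMap.det_smul, LinearMap.transvection.det, hf, h.inner_self, h.polar_normal,
      finrank_euclideanSpace_fin]
    ring
  rw [himage, image_add_left, measure_preimage_add, Measure.addHaar_image_linearMap, hdet,
    abs_of_pos (by positivity)]

/-- On bounded sets, the rescaled body is squeezed between vertical translates of the
paraboloid `⟪v, N⟫ = Q v`. -/
theorem IsParaboloidal.eventually_sandwich (h : IsParaboloidal K X₀ N Q) (hY₀ : ⟪Y₀, N⟫_ℝ = 0)
    (R : ℝ) {ε : ℝ} (hε : 0 < ε) :
    ∀ᶠ s in 𝓝[>] (0 : ℝ), ∀ v ∈ closedBall (0 : EuclideanSpace ℝ (Fin n)) R,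
      (Q v + ε < ⟪v, N⟫_ℝ → paraMap X₀ N Q Y₀ s v ∈ K) ∧
      (paraMap X₀ N Q Y₀ s v ∈ K → Q v - ε ≤ ⟪v, N⟫_ℝ) := by
  have hQc := Q.continuous_of_finiteDimensional
  obtain ⟨M, hM⟩ :=
    (isCompact_closedBall (0 : EuclideanSpace ℝ (Fin n)) R).exists_bound_of_continuousOn
    (f := fun v => Q v + Q Y₀ + QuadraticMap.polar Q Y₀ v)
    (Continuous.continuousOn (by unfold QuadraticMap.polar; fun_prop))
  have hM1 : 0 < |M| + 1 := by positivity
  obtain ⟨a, ha, hsand⟩ := h.sandwich (ε / (|M| + 1)) (by positivity)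
  have hev : ∀ᶠ s in 𝓝 (0 : ℝ), ∀ v ∈ closedBall (0 : EuclideanSpace ℝ (Fin n)) R,
      paraMap X₀ N Q Y₀ s v ∈ ball X₀ a := by
    refine (isCompact_closedBall _ R).eventually_forall_of_forall_eventually fun v _ => ?_
    refine continuous_uncurry_paraMap.continuousAt.eventually ?_
    simp only [paraMap_zero]
    exact ball_mem_nhds X₀ ha
  filter_upwards [hev.filter_mono nhdsWithin_le_nhds, self_mem_nhdsWithin] with s hs hs0 v hv
  have hs2 : 0 < s ^ 2 := pow_pos hs0 2
  obtain ⟨h1, h2⟩ := hsand _ (hs v hv)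
  rw [h.inner_paraMap_sub hY₀, h.map_paraMap_sub] at h1 h2
  set W := Q v + Q Y₀ + QuadraticMap.polar Q Y₀ v with hW
  have hWM : ε / (|M| + 1) * W < ε := by
    have hb : W < |M| + 1 := by
      have := hM v hv
      rw [Real.norm_eq_abs] at this
      linarith [le_abs_self W, le_abs_self M]
    calc ε / (|M| + 1) * W < ε / (|M| + 1) * (|M| + 1) := by gcongr
      _ = ε := by field_simp
  refine ⟨fun hlt => h1 ?_, fun hmem => ?_⟩
  · have : s ^ 2 * ((1 + ε / (|M| + 1)) * W) <
        s ^ 2 * (⟪v, N⟫_ℝ + Q Y₀ + QuadraticMap.polar Q Y₀ v) := by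
      gcongr
      linarith
    linarith
  · have h3 : s ^ 2 * ((1 - ε / (|M| + 1)) * W) ≤
        s ^ 2 * (⟪v, N⟫_ℝ + Q Y₀ + QuadraticMap.polar Q Y₀ v) := by linarith [h2 hmem]
    have := le_of_mul_le_mul_left h3 hs2
    linarith

theorem IsParaboloidal.exists_coercive (h : IsParaboloidal K X₀ N Q) :
    ∃ c > 0, ∀ v, c * ‖v‖ ^ 2 ≤ Q v + ⟪v, N⟫_ℝ ^ 2 := by
  have hQc := Q.continuous_of_finiteDimensional
  have hpos : ∀ v ∈ sphere (0 : EuclideanSpace ℝ (Fin n)) 1, 0 < Q v + ⟪v, N⟫_ℝ ^ 2 := by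
    intro v hv
    have hv0 : v ≠ 0 := ne_of_mem_sphere hv one_ne_zero
    rcases eq_or_ne ⟪v, N⟫_ℝ 0 with h0 | h0
    · have := h.pos v h0 hv0
      positivity
    · have := h.nonneg v
      positivity
  obtain ⟨c, hc, hcv⟩ : ∃ c > 0, ∀ v ∈ sphere (0 : EuclideanSpace ℝ (Fin n)) 1,
      c ≤ Q v + ⟪v, N⟫_ℝ ^ 2 :=
    (isCompact_sphere _ _).exists_forall_le' (Continuous.continuousOn (by fun_prop)) hpos
  refine ⟨c, hc, fun v => ?_⟩
  rcases eq_or_ne v 0 with rfl | hv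
  · simp
  · have h1 := hcv (‖v‖⁻¹ • v) (by simp [norm_smul, hv])
    rw [QuadraticMap.map_smul, real_inner_smul_left, smul_eq_mul] at h1
    have hvn : 0 < ‖v‖ := norm_pos_iff.2 hv
    calc c * ‖v‖ ^ 2 ≤ (‖v‖⁻¹ * ‖v‖⁻¹ * Q v + (‖v‖⁻¹ * ⟪v, N⟫_ℝ) ^ 2) * ‖v‖ ^ 2 := by gcongr
      _ = Q v + ⟪v, N⟫_ℝ ^ 2 := by field_simp

end paraMap

theorem Convex.mem_convexHull_insert {E : Type*} [AddCommGroup E] [Module ℝ E] {K : Set E}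
    (hK : Convex ℝ K) (hne : K.Nonempty) {p x : E} :
    x ∈ convexHull ℝ (insert p K) ↔ ∃ k ∈ K, x ∈ segment ℝ p k := by
  rw [convexHull_insert hne, hK.convexHull_eq, mem_convexJoin]
  simp

theorem IsConvexBody.convexHull_insert {n : ℕ} {K : Set (EuclideanSpace ℝ (Fin n))}
    (hK : IsConvexBody K) (p : EuclideanSpace ℝ (Fin n)) :
    IsConvexBody (convexHull ℝ (insert p K)) := by
  have hsub : K ⊆ convexHull ℝ (insert p K) := (subset_insert p K).trans (subset_convexHull ℝ _)
  refine ⟨?_, convex_convexHull ℝ _, hK.2.2.mono (interior_mono hsub)⟩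
  have himage : convexHull ℝ (insert p K) =
      (fun q : ℝ × EuclideanSpace ℝ (Fin n) => AffineMap.lineMap p q.2 q.1) '' (Icc 0 1 ×ˢ K) := by
    ext x
    rw [hK.2.1.mem_convexHull_insert (hK.2.2.mono interior_subset)]
    simp only [segment_eq_image_lineMap, mem_image, Prod.exists, mem_prod]
    constructor
    · rintro ⟨k, hk, t, ht, rfl⟩
      exact ⟨t, k, ⟨ht, hk⟩, rfl⟩
    · rintro ⟨t, k, ⟨ht, hk⟩, rfl⟩
      exact ⟨k, hk, t, ht, rfl⟩
  rw [himage]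
  refine (isCompact_Icc.prod hK.1).image ?_
  simp only [AffineMap.lineMap_apply_module]
  fun_prop

theorem Convex.hausdorffDist_convexHull_insert_le {E : Type*} [NormedAddCommGroup E]
    [NormedSpace ℝ E] {K : Set E} (hK : Convex ℝ K) {x₀ : E} (hx₀ : x₀ ∈ K) (p : E) :
    hausdorffDist (convexHull ℝ (insert p K)) K ≤ dist p x₀ := by
  refine hausdorffDist_le_of_mem_dist dist_nonneg (fun x hx => ?_) fun x hx =>
    ⟨x, subset_convexHull ℝ _ (mem_insert_of_mem p hx), by simp⟩
  obtain ⟨k, hk, a, b, ha, hb, hab, rfl⟩ := (hK.mem_convexHull_insert ⟨x₀, hx₀⟩).1 hx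
  refine ⟨a • x₀ + b • k, hK hx₀ hk ha hb hab, ?_⟩
  rw [dist_add_right, dist_smul₀, Real.norm_of_nonneg ha]
  exact mul_le_of_le_one_left dist_nonneg (by linarith)

theorem IsConvexBody.volume_diff_pos {n : ℕ} {K K' : Set (EuclideanSpace ℝ (Fin n))}
    (hK : IsConvexBody K) (hK' : IsConvexBody K') {p : EuclideanSpace ℝ (Fin n)} (hp : p ∈ K' \ K) :
    0 < volume (K' \ K) := by
  have hcl : p ∈ closure (interior K') := by
    rw [hK'.2.1.closure_interior_eq_closure_of_nonempty_interior hK'.2.2]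
    exact subset_closure hp.1
  have hne : (interior K' ∩ Kᶜ).Nonempty := by
    rw [inter_comm]
    exact mem_closure_iff.1 hcl _ hK.1.isClosed.isOpen_compl hp.2
  exact ((isOpen_interior.inter hK.1.isClosed.isOpen_compl).measure_pos volume hne).trans_le
    (measure_mono fun x hx => ⟨interior_subset hx.1, hx.2⟩)

theorem moments_eq_add_diff {n : ℕ} {K K' : Set (EuclideanSpace ℝ (Fin n))}
    (hK : IsCompact K) (hK' : IsCompact K') (h : K ⊆ K') :
    moments K' = moments K + moments (K' \ K) := by
  unfold moments
  conv_lhs => rw [← union_sdiff_cancel h]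
  exact setIntegral_union disjoint_sdiff_right (hK'.measurableSet.diff hK.measurableSet)
    (integrableOn_of_subset_isCompact continuous_momentMap hK subset_rfl)
    (integrableOn_of_subset_isCompact continuous_momentMap hK' sdiff_subset)

section paraMap

variable {n : ℕ} {K S : Set (EuclideanSpace ℝ (Fin n))} {X₀ N Y₀ : EuclideanSpace ℝ (Fin n)}
  {Q : QuadraticForm ℝ (EuclideanSpace ℝ (Fin n))}

/-- Adjoining a point slightly below the vertex of an approximately parabolic convex set only
changes that set near the vertex. -/
theorem IsParaboloidal.dist_le_of_mem_segment (h : IsParaboloidal K X₀ N Q) (hS : Convex ℝ S)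
    {c ε ρ : ℝ} (hc : ∀ v, c * ‖v‖ ^ 2 ≤ Q v + ⟪v, N⟫_ℝ ^ 2) (hε : 0 < ε) (hερ : 4 * ε ≤ ρ)
    (hρ : ρ ≤ 1) (hcε : 18 * ε + 169 * ε ^ 2 < c * (ρ / 2) ^ 2) (hc0 : 0 < c)
    (hsand : ∀ v ∈ closedBall (0 : EuclideanSpace ℝ (Fin n)) 3,
      (Q v + ε < ⟪v, N⟫_ℝ → v ∈ S) ∧ (v ∈ S → Q v - ε ≤ ⟪v, N⟫_ℝ))
    {k x : EuclideanSpace ℝ (Fin n)} (hk : k ∈ S) (hx : x ∈ segment ℝ (-(2 * ε) • N) k)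
    (hxS : x ∉ S) : dist x (-(2 * ε) • N) ≤ ρ := by
  by_contra! hdist
  set P := -(2 * ε) • N with hP
  have hPn : ‖P‖ = 2 * ε := by rw [hP, norm_smul, h.norm_eq]; simp [abs_of_pos hε]
  clear_value P
  have hd0 : 0 < dist x P := by linarith
  obtain ⟨a, b, ha, hb, hab, rfl⟩ := hx
  set x := a • P + b • k with hxdef
  set θ := ρ / dist x P with hθ
  have hθ0 : 0 < θ := div_pos (by linarith) hd0
  have hθ1 : θ < 1 := (div_lt_one hd0).2 hdist
  have hxP : x - P = b • (k - P) := by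
    obtain rfl : a = 1 - b := by linarith
    rw [hxdef]; module
  have hnot : ∀ t : ℝ, 0 < t → t ≤ 1 → P + t • (x - P) ∉ S := by
    intro t ht0 ht1 hmem
    apply hxS
    have htb : t * b ≤ b := mul_le_of_le_one_left hb ht1
    rcases eq_or_ne (t * b) 1 with h1 | h1
    · obtain rfl : b = 1 := by linarith
      obtain rfl : a = 0 := by linarith
      simpa [hxdef] using hk
    · have hlt : 0 < 1 - t * b := by
        rcases lt_or_gt_of_ne h1 with h2 | h2 <;> linarith
      have hne := hlt.ne'
      have := hS hmem hk (a := a / (1 - t * b)) (b := (b - t * b) / (1 - t * b))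
        (by positivity) (div_nonneg (by linarith) hlt.le) (by field_simp; linarith)
      convert this using 1
      have hi := inv_mul_cancel₀ hne
      rw [hxP, hxdef, div_eq_inv_mul, div_eq_inv_mul]
      obtain rfl : a = 1 - b := by linarith
      generalize (1 - t * b)⁻¹ = i at hi
      match_scalars
      · linear_combination (b - 1) * hi
      · linear_combination (-b) * hi
  set x' := P + θ • (x - P) with hx'
  have hx'P : ‖x' - P‖ = ρ := by
    rw [hx', add_sub_cancel_left, norm_smul, Real.norm_of_nonneg hθ0.le, ← dist_eq_norm, hθ,
      div_mul_cancel₀ _ hd0.ne']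
  have hx'n : ‖x'‖ ≤ ρ + 2 * ε := by
    calc ‖x'‖ = ‖(x' - P) + P‖ := by rw [sub_add_cancel]
      _ ≤ _ := by rw [← hx'P, ← hPn]; exact norm_add_le _ _
  have hx'n' : ρ / 2 ≤ ‖x'‖ := by
    have := norm_sub_le x' P
    linarith
  have hm : P + (θ / 2) • (x - P) ∉ S := hnot _ (by positivity) (by linarith)
  have hmx : P + (θ / 2) • (x - P) = (1 / 2 : ℝ) • x' + (-ε) • N := by
    rw [hx', hP]; module
  have hup : x' + ((1 - θ * b) * (4 * ε)) • N ∈ S := by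
    have htop : (2 * ε) • N ∈ S := by
      refine (hsand _ ?_).1 ?_
      · rw [mem_closedBall_zero_iff, norm_smul, h.norm_eq, Real.norm_of_nonneg (by positivity)]
        linarith
      · have := h.map_add_smul 0 (2 * ε)
        rw [zero_add, QuadraticMap.map_zero] at this
        rw [this, real_inner_smul_left, h.inner_self]
        linarith
    have hθb : θ * b ≤ 1 := mul_le_one₀ hθ1.le hb (by linarith)
    have := hS htop hk (a := 1 - θ * b) (b := θ * b) (by linarith) (by positivity) (by ring)
    convert this using 1
    rw [hx', hxP, hP]
    module
  have hθb0 : 0 ≤ θ * b := by positivity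
  have hθb1 : θ * b ≤ 1 := mul_le_one₀ hθ1.le hb (by linarith)
  have h5 : (1 - θ * b) * (4 * ε) ≤ 4 * ε := mul_le_of_le_one_left (by positivity) (by linarith)
  have hball : ‖x' + ((1 - θ * b) * (4 * ε)) • N‖ ≤ 3 := by
    refine (norm_add_le _ _).trans ?_
    rw [norm_smul, h.norm_eq, Real.norm_of_nonneg (mul_nonneg (by linarith) (by positivity))]
    linarith
  have hball' : ‖(1 / 2 : ℝ) • x' + (-ε) • N‖ ≤ 3 := by
    refine (norm_add_le _ _).trans ?_
    rw [norm_smul, norm_smul, h.norm_eq, norm_neg, Real.norm_of_nonneg hε.le,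
      Real.norm_of_nonneg (by norm_num)]
    linarith
  have h1 := (hsand _ (mem_closedBall_zero_iff.2 hball)).2 hup
  have h2 := mt (hsand _ (mem_closedBall_zero_iff.2 hball')).1 (hmx ▸ hm)
  rw [h.map_add_smul, inner_add_left, real_inner_smul_left, h.inner_self] at h1
  rw [not_lt, h.map_add_smul, inner_add_left, real_inner_smul_left, real_inner_smul_left,
    h.inner_self, QuadraticMap.map_smul, smul_eq_mul] at h2
  have h3 := hc x'
  have h4 := h.nonneg x'
  have h6 : Q x' ≤ 18 * ε := by linarith
  have h7 : ⟪x', N⟫_ℝ ^ 2 ≤ (13 * ε) ^ 2 := sq_le_sq' (by linarith) (by linarith)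
  have h8 : c * (ρ / 2) ^ 2 ≤ c * ‖x'‖ ^ 2 := by gcongr; linarith
  linarith

end paraMap

/-- `φ` is the density of the first variation of `isoFun` at the moments of `K`, under adding or
removing a set of small volume. -/
def HasFirstVariation {n : ℕ} (K : Set (EuclideanSpace ℝ (Fin n)))
    (φ : EuclideanSpace ℝ (Fin n) → ℝ) : Prop :=
  ∀ S, IsCompact S → ∃ C ≥ 0, ∃ η > 0, ∀ D ⊆ S, (volume D).toReal < η → ∀ σ : ℝ, |σ| = 1 →
    |isoFun (moments K + σ • moments D) - isoFun (moments K) - σ * ∫ x in D, φ x| ≤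
      C * (volume D).toReal ^ 2

section paraMap

variable {n : ℕ} {K : Set (EuclideanSpace ℝ (Fin n))} {X₀ N Y₀ : EuclideanSpace ℝ (Fin n)}
  {Q : QuadraticForm ℝ (EuclideanSpace ℝ (Fin n))} {φ : EuclideanSpace ℝ (Fin n) → ℝ}

/-- If the first variation is positive near a boundary point, of the order of the square of the
scale, then adding a small cap increases the isotropy constant. -/
theorem IsParaboloidal.exists_isoL_lt_of_le (hn : 2 ≤ n) (hK : IsConvexBody K) (hX₀ : X₀ ∈ K)
    (h : IsParaboloidal K X₀ N Q) (hY₀ : ⟪Y₀, N⟫_ℝ = 0) (hφc : Continuous φ)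
    (hvar : HasFirstVariation K φ) {κ ρ : ℝ} (hκ : 0 < κ) (hρ : 0 < ρ)
    (hφ : ∀ᶠ s in 𝓝[>] (0 : ℝ), ∀ v ∈ closedBall (0 : EuclideanSpace ℝ (Fin n)) ρ,
      κ * s ^ 2 ≤ φ (paraMap X₀ N Q Y₀ s v)) {ε : ℝ} (hε : 0 < ε) :
    ∃ K', IsConvexBody K' ∧ hausdorffDist K' K < ε ∧ isoL n K < isoL n K' := by
  obtain ⟨c, hc0, hc⟩ := h.exists_coercive
  set r := min (ρ / 2) 1 with hr
  have hr0 : 0 < r := by positivity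
  obtain ⟨δ, ⟨hδr, hδc⟩, hδ0⟩ : ∃ δ : ℝ, (4 * δ < r ∧ 18 * δ + 169 * δ ^ 2 < c * (r / 2) ^ 2) ∧
      0 < δ := by
    refine Filter.Eventually.exists (f := 𝓝[>] (0 : ℝ)) (Filter.Eventually.and
      (Filter.Eventually.filter_mono nhdsWithin_le_nhds (Filter.Eventually.and ?_ ?_))
      self_mem_nhdsWithin)
    · exact (Continuous.tendsto' (by fun_prop) (0 : ℝ) (0 : ℝ) (by simp)).eventually
        (eventually_lt_nhds hr0)
    · exact (Continuous.tendsto' (by fun_prop) (0 : ℝ) (0 : ℝ) (by simp)).eventually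
        (eventually_lt_nhds (by positivity))
  have hrρ : r ≤ ρ / 2 := min_le_left _ _
  set P : EuclideanSpace ℝ (Fin n) := -(2 * δ) • N with hP
  have hPn : ‖P‖ = 2 * δ := by rw [hP, norm_smul, h.norm_eq]; simp [abs_of_pos hδ0]
  obtain ⟨C, hC, η, hη, hvar⟩ := hvar
    ((fun p : ℝ × EuclideanSpace ℝ (Fin n) => paraMap X₀ N Q Y₀ p.1 p.2) ''
      (Icc 0 1 ×ˢ closedBall 0 ρ))
    ((isCompact_Icc.prod (isCompact_closedBall _ _)).image continuous_uncurry_paraMap)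
  set W := (volume (closedBall (0 : EuclideanSpace ℝ (Fin n)) ρ)).toReal with hW
  have hev : ∀ᶠ s in 𝓝 (0 : ℝ), s < 1 ∧ s ^ (n + 1) * W < η ∧ C * (s * W) < κ ∧
      dist (paraMap X₀ N Q Y₀ s P) X₀ < ε := by
    refine (eventually_lt_nhds one_pos).and (Filter.Eventually.and ?_ (Filter.Eventually.and ?_ ?_))
    · exact (Continuous.tendsto' (by fun_prop) (0 : ℝ) (0 : ℝ) (by simp)).eventually
        (eventually_lt_nhds hη)
    · exact (Continuous.tendsto' (by fun_prop) (0 : ℝ) (0 : ℝ) (by simp)).eventually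
        (eventually_lt_nhds hκ)
    · have hcont : Continuous fun s => dist (paraMap X₀ N Q Y₀ s P) X₀ :=
        (continuous_uncurry_paraMap.comp (continuous_id.prodMk continuous_const)).dist
          continuous_const
      exact (hcont.tendsto' 0 0 (by simp [paraMap_zero])).eventually (eventually_lt_nhds hε)
  obtain ⟨s, ⟨⟨hs1, hsη, hsκ, hsε⟩, hsand, hφs⟩, hs0⟩ :=
    ((hev.filter_mono nhdsWithin_le_nhds).and
      ((h.eventually_sandwich hY₀ 3 hδ0).and hφ)).and self_mem_nhdsWithin |>.exists
  replace hs0 : 0 < s := hs0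
  set p := paraMap X₀ N Q Y₀ s P with hp
  set K' := convexHull ℝ (insert p K) with hK'def
  have hK' : IsConvexBody K' := hK.convexHull_insert p
  have hKK' : K ⊆ K' := (subset_insert p K).trans (subset_convexHull ℝ _)
  have hpK' : p ∈ K' := subset_convexHull ℝ _ (mem_insert p K)
  have hpK : p ∉ K := by
    intro hmem
    have h1 := (hsand P (by rw [mem_closedBall_zero_iff, hPn]; linarith [min_le_right (ρ / 2) 1])).2
      hmem
    have h2 := h.nonneg P
    rw [hP, real_inner_smul_left, h.inner_self, ← hP] at h1
    linarith
  have hD : K' \ K ⊆ paraMap X₀ N Q Y₀ s '' closedBall 0 ρ := by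
    rintro x ⟨hxK', hxK⟩
    obtain ⟨k, hk, a, b, ha, hb, hab, rfl⟩ := (hK.2.1.mem_convexHull_insert ⟨X₀, hX₀⟩).1 hxK'
    obtain ⟨w, rfl⟩ := h.surjective_paraMap hY₀ hs0 k
    rw [hp, ← paraMap_convexCombo s P w hab] at hxK ⊢
    refine mem_image_of_mem _ ?_
    have hdist := h.dist_le_of_mem_segment (convex_preimage_paraMap hK.2.1 s) hc hδ0 hδr.le
      (min_le_right _ _) hδc hc0 hsand hk ⟨a, b, ha, hb, hab, rfl⟩ hxK
    rw [mem_closedBall_zero_iff]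
    have := norm_le_norm_add_norm_sub' (a • P + b • w) P
    rw [← dist_eq_norm] at this
    linarith
  have hvol : (volume (K' \ K)).toReal ≤ s ^ (n + 1) * W := by
    have h1 := measure_mono (μ := volume) hD
    rw [h.volume_image_paraMap hs0] at h1
    have h2 := ENNReal.toReal_mono (ENNReal.mul_ne_top ENNReal.ofReal_ne_top
      measure_closedBall_lt_top.ne) h1
    rwa [ENNReal.toReal_mul, ENNReal.toReal_ofReal (by positivity)] at h2
  have hfin : volume (K' \ K) ≠ ⊤ := measure_ne_top_of_subset sdiff_subset hK'.1.measure_ne_top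
  have hvol0 : 0 < (volume (K' \ K)).toReal :=
    ENNReal.toReal_pos (hK.volume_diff_pos hK' ⟨hpK', hpK⟩).ne' hfin
  have hint : (volume (K' \ K)).toReal * (κ * s ^ 2) ≤ ∫ x in K' \ K, φ x := by
    refine setIntegral_ge_of_const_le (hK'.1.measurableSet.diff hK.1.measurableSet) hfin ?_
      (integrableOn_of_subset_isCompact hφc hK'.1 sdiff_subset)
    intro x hx
    obtain ⟨v, hv, rfl⟩ := hD hx
    exact hφs v hv
  have hgain := hvar (K' \ K) (hD.trans ?_) (hvol.trans_lt hsη) 1 abs_one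
  · rw [one_smul, one_mul, ← moments_eq_add_diff hK.1 hK'.1 hKK'] at hgain
    refine ⟨K', hK', (hK.2.1.hausdorffDist_convexHull_insert_le hX₀ p).trans_lt hsε,
      IsConvexBody.isoL_lt_isoL hn hK hK' ?_⟩
    set d := (volume (K' \ K)).toReal with hd
    have hlow := (abs_le.1 hgain).1
    have hpow : s ^ (n + 1) ≤ s ^ 2 * s := by
      rw [← pow_succ]
      exact pow_le_pow_of_le_one hs0.le hs1.le (by omega)
    have hCd : C * d < κ * s ^ 2 := by
      have hW0 : 0 ≤ W := ENNReal.toReal_nonneg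
      calc C * d ≤ C * (s ^ 2 * s * W) := by gcongr; exact hvol.trans (by gcongr)
        _ = C * (s * W) * s ^ 2 := by ring
        _ < κ * s ^ 2 := by gcongr
    nlinarith
  · rintro _ ⟨v, hv, rfl⟩
    exact ⟨(s, v), ⟨⟨hs0.le, hs1.le⟩, hv⟩, rfl⟩

end paraMap

section cut

variable {n : ℕ} {K : Set (EuclideanSpace ℝ (Fin n))} {X₀ N : EuclideanSpace ℝ (Fin n)}
  {Q : QuadraticForm ℝ (EuclideanSpace ℝ (Fin n))} {φ : EuclideanSpace ℝ (Fin n) → ℝ}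

theorem IsConvexBody.inter_halfspace (hK : IsConvexBody K) {c : EuclideanSpace ℝ (Fin n)} {t : ℝ}
    (hc : c ∈ interior K) (ht : t < ⟪c - X₀, N⟫_ℝ) :
    IsConvexBody (K ∩ {x | t ≤ ⟪x - X₀, N⟫_ℝ}) := by
  have hcont : Continuous fun x : EuclideanSpace ℝ (Fin n) => ⟪x - X₀, N⟫_ℝ := by fun_prop
  refine ⟨hK.1.inter_right (isClosed_le continuous_const hcont), hK.2.1.inter ?_, c, ?_⟩
  · intro x hx y hy a b ha hb hab
    simp only [mem_ofPred_eq, inner_sub_left, inner_add_left, real_inner_smul_left] at hx hy ⊢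
    obtain rfl : a = 1 - b := by linarith
    nlinarith
  · rw [interior_inter]
    exact ⟨hc, interior_maximal (fun x (hx : t < _) => hx.le)
      (isOpen_lt continuous_const hcont) ht⟩

theorem IsConvexBody.hausdorffDist_inter_halfspace_le (hK : IsConvexBody K)
    {c : EuclideanSpace ℝ (Fin n)} {t : ℝ} (hsupp : ∀ x ∈ K, 0 ≤ ⟪x - X₀, N⟫_ℝ)
    (hc : c ∈ K) (ht0 : 0 ≤ t) (ht : t < ⟪c - X₀, N⟫_ℝ) :
    hausdorffDist (K ∩ {x | t ≤ ⟪x - X₀, N⟫_ℝ}) K ≤ t / ⟪c - X₀, N⟫_ℝ * diam K := by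
  set y := ⟪c - X₀, N⟫_ℝ with hy
  have hy0 : 0 < y := ht0.trans_lt ht
  have hty : t / y ≤ 1 := (div_le_one hy0).2 ht.le
  have hty0 : 0 ≤ t / y := by positivity
  have hr : 0 ≤ t / y * diam K := mul_nonneg hty0 diam_nonneg
  refine hausdorffDist_le_of_mem_dist hr (fun x hx => ⟨x, hx.1, by rwa [dist_self]⟩) fun x hx => ?_
  refine ⟨(1 - t / y) • x + (t / y) • c, ⟨hK.2.1 hx hc (by linarith) hty0 (by ring), ?_⟩, ?_⟩
  · have h1 : (1 - t / y) • x + (t / y) • c - X₀ = (1 - t / y) • (x - X₀) + (t / y) • (c - X₀) := by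
      module
    rw [mem_ofPred_eq, h1, inner_add_left, real_inner_smul_left, real_inner_smul_left, ← hy,
      div_mul_cancel₀ _ hy0.ne']
    have := mul_nonneg (by linarith : 0 ≤ 1 - t / y) (hsupp x hx)
    linarith
  · have h1 : x - ((1 - t / y) • x + (t / y) • c) = (t / y) • (x - c) := by module
    rw [dist_eq_norm, h1, norm_smul, Real.norm_of_nonneg hty0, ← dist_eq_norm]
    gcongr
    exact dist_le_diam_of_mem hK.1.isBounded hx hc

theorem IsParaboloidal.norm_le_of_mem_preimage (h : IsParaboloidal K X₀ N Q) (hK : Convex ℝ K)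
    (hX₀ : X₀ ∈ K) {c R s : ℝ} (hc : ∀ v, c * ‖v‖ ^ 2 ≤ Q v + ⟪v, N⟫_ℝ ^ 2) (hR : 0 < R)
    (hcR : 3 < c * R ^ 2) (hs : 0 < s)
    (hsand : ∀ v ∈ closedBall (0 : EuclideanSpace ℝ (Fin n)) R,
      paraMap X₀ N Q 0 s v ∈ K → Q v - 1 ≤ ⟪v, N⟫_ℝ)
    {v : EuclideanSpace ℝ (Fin n)} (hv : paraMap X₀ N Q 0 s v ∈ K) (hv1 : ⟪v, N⟫_ℝ < 1) :
    ‖v‖ ≤ R := by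
  by_contra! hRv
  have hv0 : 0 < ‖v‖ := hR.trans hRv
  have hz : 0 ≤ ⟪v, N⟫_ℝ := by
    have := h.support _ hv
    rw [h.inner_paraMap_sub (inner_zero_left _), QuadraticMap.map_zero,
      QuadraticMap.polar_zero_left, add_zero, add_zero] at this
    exact nonneg_of_mul_nonneg_right this (by positivity)
  set θ := R / ‖v‖ with hθ
  have hθ0 : 0 < θ := by positivity
  have hθ1 : θ ≤ 1 := ((div_lt_one hv0).2 hRv).le
  have hmem : paraMap X₀ N Q 0 s (θ • v) ∈ K := by
    have h0 : paraMap X₀ N Q 0 s 0 ∈ K := by simpa [paraMap] using hX₀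
    have := convex_preimage_paraMap hK s hv h0 hθ0.le (by linarith : 0 ≤ 1 - θ) (by ring)
    rwa [smul_zero, add_zero] at this
  have hn : ‖θ • v‖ = R := by
    rw [norm_smul, Real.norm_of_nonneg hθ0.le, hθ, div_mul_cancel₀ _ hv0.ne']
  have h1 := hsand (θ • v) (by rw [mem_closedBall_zero_iff, hn]) hmem
  have h2 := hc (θ • v)
  rw [hn] at h2
  have h3 : ⟪θ • v, N⟫_ℝ ≤ 1 := by
    rw [real_inner_smul_left]
    exact mul_le_one₀ hθ1 hz hv1.le
  have h4 : 0 ≤ ⟪θ • v, N⟫_ℝ := by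
    rw [real_inner_smul_left]
    positivity
  nlinarith

/-- If the first variation is negative on a cap, up to an error of smaller order than the square
of the scale, then removing this cap increases the isotropy constant. -/
theorem IsParaboloidal.exists_isoL_lt_of_ge (hn : 2 ≤ n) (hK : IsConvexBody K) (hX₀ : X₀ ∈ K)
    (h : IsParaboloidal K X₀ N Q) (hφc : Continuous φ)
    (hvar : HasFirstVariation K φ) {a : ℝ} (ha : 0 < a)
    (hφ : ∀ R, ∀ δ > 0, ∀ᶠ s in 𝓝[>] (0 : ℝ),
      ∀ v ∈ closedBall (0 : EuclideanSpace ℝ (Fin n)) R,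
        φ (paraMap X₀ N Q 0 s v) ≤ s ^ 2 * (a * (Q v - ⟪v, N⟫_ℝ) + δ)) {ε : ℝ} (hε : 0 < ε) :
    ∃ K', IsConvexBody K' ∧ hausdorffDist K' K < ε ∧ isoL n K < isoL n K' := by
  have hQc := Q.continuous_of_finiteDimensional
  obtain ⟨c, hc0, hc⟩ := h.exists_coercive
  obtain ⟨x₁, hx₁⟩ := hK.2.2
  have hy₁ := inner_sub_pos_of_mem_interior h.norm_eq h.support hx₁
  set y₁ := ⟪x₁ - X₀, N⟫_ℝ with hy₁def
  set R := 1 + 3 / c with hR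
  have hR1 : 1 < R := by
    have : 0 < 3 / c := by positivity
    linarith
  have hcR : 3 < c * R ^ 2 := by
    have : c * R = c + 3 := by rw [hR]; field_simp
    nlinarith
  obtain ⟨r, hr0, hr⟩ : ∃ r > 0, ∀ v ∈ closedBall ((1 / 2 : ℝ) • N) r,
      Q v + 1 / 4 < ⟪v, N⟫_ℝ ∧ ⟪v, N⟫_ℝ < 1 ∧ ‖v‖ < R := by
    have hQN : Q ((1 / 2 : ℝ) • N) = 0 := by
      simpa using h.map_add_smul 0 (1 / 2)
    have hev : ∀ᶠ v in 𝓝 ((1 / 2 : ℝ) • N), Q v + 1 / 4 < ⟪v, N⟫_ℝ ∧ ⟪v, N⟫_ℝ < 1 ∧ ‖v‖ < R := by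
      have hcont : Continuous fun v : EuclideanSpace ℝ (Fin n) => ⟪v, N⟫_ℝ := by fun_prop
      refine ((hQc.add continuous_const).continuousAt.eventually_lt hcont.continuousAt ?_).and
        ((hcont.continuousAt.eventually_lt continuousAt_const ?_).and
          (continuous_norm.continuousAt.eventually_lt continuousAt_const ?_))
      · rw [Pi.add_apply, hQN, real_inner_smul_left, h.inner_self]; norm_num
      · rw [real_inner_smul_left, h.inner_self]; norm_num
      · rw [norm_smul, h.norm_eq, Real.norm_of_nonneg (by norm_num)]; linarith
    obtain ⟨r, hr0, hr⟩ := nhds_basis_closedBall.mem_iff.1 hev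
    exact ⟨r, hr0, fun v hv => hr hv⟩
  set v₁ := (volume (closedBall ((1 / 2 : ℝ) • N) r)).toReal with hv₁
  set v₂ := (volume (closedBall (0 : EuclideanSpace ℝ (Fin n)) R)).toReal with hv₂
  have hv₁0 : 0 < v₁ :=
    ENNReal.toReal_pos (measure_closedBall_pos _ _ hr0).ne' measure_closedBall_lt_top.ne
  have hv₂0 : 0 ≤ v₂ := ENNReal.toReal_nonneg
  obtain ⟨δ, ⟨hδ1, hδv⟩, hδ0⟩ : ∃ δ : ℝ, (δ < 1 / 4 ∧ (a * δ + δ) * v₂ < a * v₁ / 8) ∧ 0 < δ := by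
    refine Filter.Eventually.exists (f := 𝓝[>] (0 : ℝ)) (Filter.Eventually.and
      (Filter.Eventually.filter_mono nhdsWithin_le_nhds (Filter.Eventually.and ?_ ?_))
      self_mem_nhdsWithin)
    · exact eventually_lt_nhds (by norm_num)
    · exact (Continuous.tendsto' (by fun_prop) (0 : ℝ) (0 : ℝ) (by simp)).eventually
        (eventually_lt_nhds (by positivity))
  obtain ⟨C, hC, η, hη, hvar⟩ := hvar K hK.1
  have hev : ∀ᶠ s in 𝓝 (0 : ℝ), s < 1 ∧ s ^ (n + 1) * v₂ < η ∧ C * v₂ ^ 2 * s < a * v₁ / 8 ∧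
      s ^ 2 < y₁ ∧ s ^ 2 / y₁ * diam K < ε := by
    refine (eventually_lt_nhds one_pos).and (Filter.Eventually.and ?_ (Filter.Eventually.and ?_
      (Filter.Eventually.and ?_ ?_)))
    · exact (Continuous.tendsto' (by fun_prop) (0 : ℝ) (0 : ℝ) (by simp)).eventually
        (eventually_lt_nhds hη)
    · exact (Continuous.tendsto' (by fun_prop) (0 : ℝ) (0 : ℝ) (by simp)).eventually
        (eventually_lt_nhds (by positivity))
    · exact (Continuous.tendsto' (by fun_prop) (0 : ℝ) (0 : ℝ) (by simp)).eventually
        (eventually_lt_nhds hy₁)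
    · exact (Continuous.tendsto' (by fun_prop) (0 : ℝ) (0 : ℝ) (by simp)).eventually
        (eventually_lt_nhds hε)
  obtain ⟨s, ⟨⟨hs1, hsη, hsC, hsy, hsε⟩, hsand, hφs⟩, hs0⟩ :=
    ((hev.filter_mono nhdsWithin_le_nhds).and
      ((h.eventually_sandwich (inner_zero_left _) R hδ0).and (hφ R δ hδ0))).and
      self_mem_nhdsWithin |>.exists
  replace hs0 : 0 < s := hs0
  have hinner : ∀ v, ⟪paraMap X₀ N Q 0 s v - X₀, N⟫_ℝ = s ^ 2 * ⟪v, N⟫_ℝ := fun v => by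
    rw [h.inner_paraMap_sub (inner_zero_left _), QuadraticMap.map_zero,
      QuadraticMap.polar_zero_left, add_zero, add_zero]
  set K' := K ∩ {x | s ^ 2 ≤ ⟪x - X₀, N⟫_ℝ} with hK'def
  have hK' : IsConvexBody K' := hK.inter_halfspace hx₁ hsy
  have hK'K : K' ⊆ K := inter_subset_left
  have hD : ∀ x ∈ K \ K', ∃ v ∈ closedBall (0 : EuclideanSpace ℝ (Fin n)) R,
      Q v - δ ≤ ⟪v, N⟫_ℝ ∧ paraMap X₀ N Q 0 s v = x := by
    rintro x ⟨hxK, hxK'⟩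
    obtain ⟨v, rfl⟩ := h.surjective_paraMap (inner_zero_left _) hs0 x
    have hv1 : ⟪v, N⟫_ℝ < 1 := by
      by_contra! hv1
      refine hxK' ⟨hxK, ?_⟩
      rw [mem_ofPred_eq, hinner]
      exact le_mul_of_one_le_right (by positivity) hv1
    have hvR : v ∈ closedBall (0 : EuclideanSpace ℝ (Fin n)) R := by
      rw [mem_closedBall_zero_iff]
      refine h.norm_le_of_mem_preimage hK.2.1 hX₀ hc (by linarith) hcR hs0 ?_ hxK hv1
      intro w hw hwK
      linarith [(hsand w hw).2 hwK]
    exact ⟨v, hvR, (hsand v hvR).2 hxK, rfl⟩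
  have hE : paraMap X₀ N Q 0 s '' closedBall ((1 / 2 : ℝ) • N) r ⊆ K \ K' := by
    rintro _ ⟨v, hv, rfl⟩
    obtain ⟨h1, h2, h3⟩ := hr v hv
    refine ⟨(hsand v (mem_closedBall_zero_iff.2 h3.le)).1 (by linarith), fun hmem => ?_⟩
    have h4 := hmem.2
    rw [mem_ofPred_eq, hinner] at h4
    have h5 : s ^ 2 * ⟪v, N⟫_ℝ < s ^ 2 * 1 := by gcongr
    linarith
  set E := paraMap X₀ N Q 0 s '' closedBall ((1 / 2 : ℝ) • N) r with hEdef
  have hEc : IsCompact E := (isCompact_closedBall _ _).image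
    (continuous_uncurry_paraMap.comp (continuous_const.prodMk continuous_id))
  have hEvol : (volume E).toReal = s ^ (n + 1) * v₁ := by
    rw [hEdef, h.volume_image_paraMap hs0, ENNReal.toReal_mul,
      ENNReal.toReal_ofReal (by positivity)]
  have hDvol : (volume (K \ K')).toReal ≤ s ^ (n + 1) * v₂ := by
    have h1 : K \ K' ⊆ paraMap X₀ N Q 0 s '' closedBall 0 R := fun x hx => by
      obtain ⟨v, hv, -, rfl⟩ := hD x hx
      exact mem_image_of_mem _ hv
    have h2 := measure_mono (μ := volume) h1
    rw [h.volume_image_paraMap hs0] at h2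
    have h3 := ENNReal.toReal_mono (ENNReal.mul_ne_top ENNReal.ofReal_ne_top
      measure_closedBall_lt_top.ne) h2
    rwa [ENNReal.toReal_mul, ENNReal.toReal_ofReal (by positivity)] at h3
  have hDfin : volume (K \ K') ≠ ⊤ := measure_ne_top_of_subset sdiff_subset hK.1.measure_ne_top
  have hDm : MeasurableSet (K \ K') := hK.1.measurableSet.diff hK'.1.measurableSet
  set m := s ^ 2 * (a * δ + δ) with hm
  have hint : ∫ x in K \ K', φ x ≤
      m * (volume (K \ K')).toReal - s ^ 2 * (a / 4) * (volume E).toReal := by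
    have hint1 : ∫ x in K \ K', (φ x - m) =
        (∫ x in K \ K', φ x) - m * (volume (K \ K')).toReal := by
      rw [integral_sub (integrableOn_of_subset_isCompact hφc hK.1 sdiff_subset)
        (integrableOn_const hDfin), setIntegral_const, smul_eq_mul, mul_comm, measureReal_def]
    have hint2 : ∫ x in K \ K', (φ x - m) ≤ ∫ x in E, (φ x - m) := by
      have := setIntegral_mono_set (μ := volume) (s := E) (t := K \ K') (f := fun x => m - φ x)
        (integrableOn_of_subset_isCompact (by fun_prop) hK.1 sdiff_subset)
        (by
          refine (ae_restrict_iff' hDm).2 (ae_of_all _ fun x hx => ?_)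
          obtain ⟨v, hv, hQv, rfl⟩ := hD x hx
          have h1 := hφs v hv
          have h2 : s ^ 2 * (a * (Q v - ⟪v, N⟫_ℝ) + δ) ≤ m := by
            rw [hm]
            gcongr
            linarith
          simp only [Pi.zero_apply]
          linarith) hE.eventuallyLE
      have hneg : ∀ A, ∫ x in A, (m - φ x) = -∫ x in A, (φ x - m) := fun A => by
        rw [← integral_neg]
        simp only [neg_sub]
      rw [hneg, hneg] at this
      linarith
    have hint3 : ∫ x in E, (φ x - m) ≤ -(s ^ 2 * (a / 4)) * (volume E).toReal := by
      have := setIntegral_mono_on (μ := volume) (s := E) (f := fun x => φ x - m)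
        (g := fun _ => -(s ^ 2 * (a / 4)))
        (integrableOn_of_subset_isCompact (by fun_prop) hEc subset_rfl)
        (integrableOn_const hEc.measure_ne_top) hEc.measurableSet ?_
      · rwa [setIntegral_const, smul_eq_mul, mul_comm] at this
      · rintro _ ⟨v, hv, rfl⟩
        obtain ⟨h1, h2, h3⟩ := hr v hv
        have h4 := hφs v (mem_closedBall_zero_iff.2 h3.le)
        have h5 : s ^ 2 * (a * (Q v - ⟪v, N⟫_ℝ) + δ) ≤ s ^ 2 * (a * (-(1 / 4)) + δ) := by
          gcongr
          linarith
        have h6 : 0 ≤ s ^ 2 * (a * δ) := by positivity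
        rw [hm]
        linarith
    linarith
  have hgain := hvar (K \ K') sdiff_subset (hDvol.trans_lt hsη) (-1) (by simp)
  have hmom : moments K + (-1 : ℝ) • moments (K \ K') = moments K' := by
    rw [moments_eq_add_diff hK'.1 hK.1 hK'K]
    module
  rw [hmom] at hgain
  refine ⟨K', hK', (hK.hausdorffDist_inter_halfspace_le h.support (interior_subset hx₁)
    (by positivity) hsy).trans_lt hsε, IsConvexBody.isoL_lt_isoL hn hK hK' ?_⟩
  rw [hEvol] at hint
  set d := (volume (K \ K')).toReal with hd
  have hd0 : 0 ≤ d := ENNReal.toReal_nonneg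
  have hlow := (abs_le.1 hgain).1
  set p := s ^ (n + 1) with hp
  have hp0 : 0 < p := by positivity
  have hpow : p ≤ s ^ 2 * s := by
    rw [← pow_succ]
    exact pow_le_pow_of_le_one hs0.le hs1.le (by omega)
  have h1 : C * d ^ 2 ≤ p * s ^ 2 * (C * v₂ ^ 2 * s) := by
    calc C * d ^ 2 ≤ C * (p * v₂) ^ 2 := by gcongr
      _ = C * v₂ ^ 2 * p * p := by ring
      _ ≤ C * v₂ ^ 2 * p * (s ^ 2 * s) := by gcongr
      _ = _ := by ring
  have h2 : p * s ^ 2 * (C * v₂ ^ 2 * s) < p * s ^ 2 * (a * v₁ / 8) := by gcongr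
  have h3 : m * d ≤ p * s ^ 2 * ((a * δ + δ) * v₂) := by
    calc m * d ≤ m * (p * v₂) := by gcongr
      _ = _ := by rw [hm]; ring
  have h4 : p * s ^ 2 * ((a * δ + δ) * v₂) < p * s ^ 2 * (a * v₁ / 8) := by gcongr
  linarith

end cut

theorem exists_ne_zero_inner_eq_zero {n : ℕ} (hn : 2 ≤ n) (N : EuclideanSpace ℝ (Fin n)) :
    ∃ Y : EuclideanSpace ℝ (Fin n), Y ≠ 0 ∧ ⟪Y, N⟫_ℝ = 0 := by
  by_contra! h
  have hinj : Function.Injective (innerₗ (EuclideanSpace ℝ (Fin n)) N) := by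
    refine (injective_iff_map_eq_zero _).2 fun Y hY => ?_
    by_contra h0
    exact h Y h0 (by rwa [real_inner_comm])
  have := LinearMap.finrank_le_finrank_of_injective hinj
  rw [finrank_euclideanSpace_fin, Module.finrank_self] at this
  omega

theorem exists_eventually_le_of_eq_pow_mul {E : Type*} [NormedAddCommGroup E] {ψ : ℝ → E → ℝ}
    {F : ℝ × E → ℝ} (hF : Continuous F) (h0 : 0 < F (0, 0)) {k : ℕ} (hk : k ≤ 2)
    (h : ∀ s v, ψ s v = s ^ k * F (s, v)) :
    ∃ κ > 0, ∃ ρ > 0, ∀ᶠ s in 𝓝[>] (0 : ℝ), ∀ v ∈ closedBall (0 : E) ρ, κ * s ^ 2 ≤ ψ s v := by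
  have hev : ∀ᶠ p in 𝓝 ((0 : ℝ), (0 : E)), F (0, 0) / 2 < F p :=
    hF.continuousAt.eventually (lt_mem_nhds (half_lt_self h0))
  rw [nhds_prod_eq] at hev
  obtain ⟨p, hp, q, hq, hpq⟩ := eventually_prod_iff.1 hev
  obtain ⟨ρ, hρ, hq⟩ := nhds_basis_closedBall.mem_iff.1 hq
  refine ⟨F (0, 0) / 2, half_pos h0, ρ, hρ, ?_⟩
  filter_upwards [hp.filter_mono nhdsWithin_le_nhds, self_mem_nhdsWithin,
    (eventually_lt_nhds one_pos).filter_mono nhdsWithin_le_nhds] with s hs hs0 hs1 v hv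
  have hFs := hpq hs (hq hv)
  replace hs0 : 0 < s := hs0
  have hpow : s ^ 2 ≤ s ^ k := pow_le_pow_of_le_one hs0.le hs1.le hk
  rw [h, mul_comm]
  gcongr

theorem inner_add_smul_add_smul_self {E : Type*} [NormedAddCommGroup E] [InnerProductSpace ℝ E]
    {B : E →L[ℝ] E} (hB : ∀ x y, ⟪B x, y⟫_ℝ = ⟪x, B y⟫_ℝ) (e Y N : E) (s t : ℝ) :
    ⟪e + s • Y + t • N, B (e + s • Y + t • N)⟫_ℝ =
      ⟪e, B e⟫_ℝ + 2 * s * ⟪e, B Y⟫_ℝ + s ^ 2 * ⟪Y, B Y⟫_ℝ + 2 * t * ⟪e, B N⟫_ℝ +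
        2 * s * t * ⟪Y, B N⟫_ℝ + t ^ 2 * ⟪N, B N⟫_ℝ := by
  have h : ∀ x y, ⟪x, B y⟫_ℝ = ⟪y, B x⟫_ℝ := fun x y => by rw [← hB, real_inner_comm]
  simp only [map_add, map_smul, inner_add_left, inner_add_right, real_inner_smul_left,
    real_inner_smul_right]
  rw [h Y e, h N e, h N Y]
  ring

section paraMap

variable {n : ℕ} {K : Set (EuclideanSpace ℝ (Fin n))} {X₀ N : EuclideanSpace ℝ (Fin n)}
  {Q : QuadraticForm ℝ (EuclideanSpace ℝ (Fin n))}

theorem inner_paraMap_sub_self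
    {B : EuclideanSpace ℝ (Fin n) →L[ℝ] EuclideanSpace ℝ (Fin n)}
    (hB : ∀ x y, ⟪B x, y⟫_ℝ = ⟪x, B y⟫_ℝ) (g Y₀ : EuclideanSpace ℝ (Fin n)) (s : ℝ)
    (v : EuclideanSpace ℝ (Fin n)) :
    ⟪paraMap X₀ N Q Y₀ s v - g, B (paraMap X₀ N Q Y₀ s v - g)⟫_ℝ =
      ⟪X₀ - g, B (X₀ - g)⟫_ℝ + 2 * s * ⟪X₀ - g, B (Y₀ + v - ⟪v, N⟫_ℝ • N)⟫_ℝ +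
      s ^ 2 * (⟪Y₀ + v - ⟪v, N⟫_ℝ • N, B (Y₀ + v - ⟪v, N⟫_ℝ • N)⟫_ℝ +
        2 * (⟪v, N⟫_ℝ + Q Y₀ + QuadraticMap.polar Q Y₀ v) * ⟪X₀ - g, B N⟫_ℝ +
        s * (2 * (⟪v, N⟫_ℝ + Q Y₀ + QuadraticMap.polar Q Y₀ v) *
          ⟪Y₀ + v - ⟪v, N⟫_ℝ • N, B N⟫_ℝ +
        s * ((⟪v, N⟫_ℝ + Q Y₀ + QuadraticMap.polar Q Y₀ v) ^ 2 * ⟪N, B N⟫_ℝ))) := by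
  have h : paraMap X₀ N Q Y₀ s v - g = (X₀ - g) + s • (Y₀ + v - ⟪v, N⟫_ℝ • N) +
      (s ^ 2 * (⟪v, N⟫_ℝ + Q Y₀ + QuadraticMap.polar Q Y₀ v)) • N := by
    rw [paraMap]
    abel
  rw [h, inner_add_smul_add_smul_self hB]
  ring

theorem IsParaboloidal.exists_isoL_lt (hn : 2 ≤ n) (hK : IsConvexBody K) (hX₀ : X₀ ∈ K)
    (h : IsParaboloidal K X₀ N Q)
    {B : EuclideanSpace ℝ (Fin n) →L[ℝ] EuclideanSpace ℝ (Fin n)} {g : EuclideanSpace ℝ (Fin n)}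
    {c : ℝ} (hB : ∀ x y, ⟪B x, y⟫_ℝ = ⟪x, B y⟫_ℝ) (hBpos : ∀ x, x ≠ 0 → 0 < ⟪x, B x⟫_ℝ)
    (hvar : HasFirstVariation K fun x => ⟪x - g, B (x - g)⟫_ℝ - c) {ε : ℝ} (hε : 0 < ε) :
    ∃ K', IsConvexBody K' ∧ hausdorffDist K' K < ε ∧ isoL n K < isoL n K' := by
  have hQc := Q.continuous_of_finiteDimensional
  have hpara := continuous_uncurry_paraMap (X₀ := X₀) (N := N) (Q := Q) (Y₀ := 0)
  set e := X₀ - g with he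
  set φ : EuclideanSpace ℝ (Fin n) → ℝ := fun x => ⟪x - g, B (x - g)⟫_ℝ - c with hφ
  have hφc : Continuous φ := by fun_prop
  have hadd : ∀ (Y₀ : EuclideanSpace ℝ (Fin n)) (F : ℝ × EuclideanSpace ℝ (Fin n) → ℝ) (k : ℕ),
      ⟪Y₀, N⟫_ℝ = 0 → Continuous F → 0 < F (0, 0) → k ≤ 2 →
      (∀ s v, φ (paraMap X₀ N Q Y₀ s v) = s ^ k * F (s, v)) →
      ∃ K', IsConvexBody K' ∧ hausdorffDist K' K < ε ∧ isoL n K < isoL n K' := by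
    intro Y₀ F k hY₀ hF h0 hk hFφ
    obtain ⟨κ, hκ, ρ, hρ, hev⟩ := exists_eventually_le_of_eq_pow_mul hF h0 hk hFφ
    exact h.exists_isoL_lt_of_le hn hK hX₀ hY₀ hφc hvar hκ hρ hev hε
  have hcut : ∀ a : ℝ, 0 < a → (∀ δ > 0, ∀ v, ∀ᶠ p in 𝓝 ((0 : ℝ), v),
      φ (paraMap X₀ N Q 0 p.1 p.2) ≤ p.1 ^ 2 * (a * (Q p.2 - ⟪p.2, N⟫_ℝ) + δ)) →
      ∃ K', IsConvexBody K' ∧ hausdorffDist K' K < ε ∧ isoL n K < isoL n K' := by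
    intro a ha hev
    refine h.exists_isoL_lt_of_ge hn hK hX₀ hφc hvar ha (fun R δ hδ => ?_) hε
    refine Filter.Eventually.filter_mono nhdsWithin_le_nhds ?_
    exact (isCompact_closedBall _ R).eventually_forall_of_forall_eventually fun v _ => hev δ hδ v
  rcases lt_trichotomy (φ X₀) 0 with h0 | h0 | h0
  · refine hcut 1 one_pos fun δ hδ v => ?_
    have hcont1 : Continuous fun p : ℝ × EuclideanSpace ℝ (Fin n) =>
        φ (paraMap X₀ N Q 0 p.1 p.2) := hφc.comp hpara
    have hcont2 : Continuous fun p : ℝ × EuclideanSpace ℝ (Fin n) =>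
        p.1 ^ 2 * (1 * (Q p.2 - ⟪p.2, N⟫_ℝ) + δ) := by fun_prop
    refine (hcont1.continuousAt.eventually_lt hcont2.continuousAt ?_).mono fun p hp => hp.le
    simpa [paraMap_zero] using h0
  · have hφ₀ : ⟪e, B e⟫_ℝ - c = 0 := h0
    by_cases hlin : ∃ Y, ⟪Y, N⟫_ℝ = 0 ∧ 0 < ⟪e, B Y⟫_ℝ
    · obtain ⟨Y₀, hY₀, hpos⟩ := hlin
      refine hadd Y₀ (fun p => 2 * ⟪e, B (Y₀ + p.2 - ⟪p.2, N⟫_ℝ • N)⟫_ℝ +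
        p.1 * (⟪Y₀ + p.2 - ⟪p.2, N⟫_ℝ • N, B (Y₀ + p.2 - ⟪p.2, N⟫_ℝ • N)⟫_ℝ +
        2 * (⟪p.2, N⟫_ℝ + Q Y₀ + QuadraticMap.polar Q Y₀ p.2) * ⟪e, B N⟫_ℝ +
        p.1 * (2 * (⟪p.2, N⟫_ℝ + Q Y₀ + QuadraticMap.polar Q Y₀ p.2) *
          ⟪Y₀ + p.2 - ⟪p.2, N⟫_ℝ • N, B N⟫_ℝ +
        p.1 * ((⟪p.2, N⟫_ℝ + Q Y₀ + QuadraticMap.polar Q Y₀ p.2) ^ 2 * ⟪N, B N⟫_ℝ)))) 1 hY₀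
        ?_ ?_ one_le_two fun s v => ?_
      · unfold QuadraticMap.polar
        fun_prop
      · simpa using hpos
      · simp only [hφ]
        rw [inner_paraMap_sub_self hB, ← he]
        linear_combination hφ₀
    · have hlin0 : ∀ Y, ⟪Y, N⟫_ℝ = 0 → ⟪e, B Y⟫_ℝ = 0 := by
        push Not at hlin
        intro Y hY
        refine le_antisymm (hlin Y hY) ?_
        have := hlin (-Y) (by rw [inner_neg_left, hY, neg_zero])
        rw [map_neg, inner_neg_right] at this
        linarith
      by_cases hquad : ∃ Y, ⟪Y, N⟫_ℝ = 0 ∧ 0 < ⟪Y, B Y⟫_ℝ + 2 * Q Y * ⟪e, B N⟫_ℝ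
      · obtain ⟨Y₀, hY₀, hpos⟩ := hquad
        refine hadd Y₀ (fun p =>
          ⟪Y₀ + p.2 - ⟪p.2, N⟫_ℝ • N, B (Y₀ + p.2 - ⟪p.2, N⟫_ℝ • N)⟫_ℝ +
          2 * (⟪p.2, N⟫_ℝ + Q Y₀ + QuadraticMap.polar Q Y₀ p.2) * ⟪e, B N⟫_ℝ +
          p.1 * (2 * (⟪p.2, N⟫_ℝ + Q Y₀ + QuadraticMap.polar Q Y₀ p.2) *
            ⟪Y₀ + p.2 - ⟪p.2, N⟫_ℝ • N, B N⟫_ℝ +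
          p.1 * ((⟪p.2, N⟫_ℝ + Q Y₀ + QuadraticMap.polar Q Y₀ p.2) ^ 2 * ⟪N, B N⟫_ℝ))) 2 hY₀
          ?_ ?_ le_rfl fun s v => ?_
        · unfold QuadraticMap.polar
          fun_prop
        · simpa using hpos
        · simp only [hφ]
          rw [inner_paraMap_sub_self hB, ← he, hlin0 (Y₀ + v - ⟪v, N⟫_ℝ • N)]
          · linear_combination hφ₀
          · rw [add_sub_assoc, inner_add_left, hY₀, inner_sub_smul_self h.norm_eq, zero_add]
      · push Not at hquad
        have ha : ⟪e, B N⟫_ℝ < 0 := by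
          obtain ⟨Y, hY0, hY⟩ := exists_ne_zero_inner_eq_zero hn N
          have h1 := hquad Y hY
          have h2 := hBpos Y hY0
          have h3 := h.pos Y hY hY0
          by_contra! h4
          have := mul_nonneg h3.le h4
          linarith
        refine hcut (-2 * ⟪e, B N⟫_ℝ) (by linarith) fun δ hδ v => ?_
        have hcont : Continuous fun p : ℝ × EuclideanSpace ℝ (Fin n) =>
            p.1 * (2 * ⟪p.2, N⟫_ℝ * ⟪p.2 - ⟪p.2, N⟫_ℝ • N, B N⟫_ℝ +
              p.1 * (⟪p.2, N⟫_ℝ ^ 2 * ⟪N, B N⟫_ℝ)) := by fun_prop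
        have hlt := hcont.continuousAt.eventually_lt (x₀ := ((0 : ℝ), v))
          (continuousAt_const (y := δ)) (by simpa using hδ)
        refine hlt.mono fun ⟨s, w⟩ hsw => ?_
        have hw := inner_sub_smul_self h.norm_eq w
        have hQw : Q (w - ⟪w, N⟫_ℝ • N) = Q w := by
          rw [← h.map_add_smul (w - ⟪w, N⟫_ℝ • N) ⟪w, N⟫_ℝ, sub_add_cancel]
        have h1 := hquad _ hw
        rw [hQw] at h1
        have h2 : φ (paraMap X₀ N Q 0 s w) = s ^ 2 *
            (⟪w - ⟪w, N⟫_ℝ • N, B (w - ⟪w, N⟫_ℝ • N)⟫_ℝ + 2 * ⟪w, N⟫_ℝ * ⟪e, B N⟫_ℝ +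
              s * (2 * ⟪w, N⟫_ℝ * ⟪w - ⟪w, N⟫_ℝ • N, B N⟫_ℝ +
              s * (⟪w, N⟫_ℝ ^ 2 * ⟪N, B N⟫_ℝ))) := by
          simp only [hφ]
          rw [inner_paraMap_sub_self hB, ← he]
          simp only [QuadraticMap.map_zero, QuadraticMap.polar_zero_left, zero_add, add_zero]
          rw [hlin0 _ hw]
          linear_combination hφ₀
        simp only at hsw ⊢
        rw [h2]
        gcongr
        linarith
  · refine hadd 0 (fun p => φ (paraMap X₀ N Q 0 p.1 p.2)) 0 (inner_zero_left _) (hφc.comp hpara)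
      ?_ zero_le_two fun s v => by simp
    simpa [paraMap_zero] using h0

end paraMap

/-- **Theorem 1 (Meyer–Reisner).** If a convex body `K` in `ℝⁿ` has positive generalized
Gauss curvature at some boundary point, then `K` is not a local maximizer for the
isotropy constant. -/
theorem not_local_maximizer_of_posGenCurvature {n : ℕ} (hn : 2 ≤ n)
    (K : Set (EuclideanSpace ℝ (Fin n))) (hK : IsConvexBody K)
    (X₀ : EuclideanSpace ℝ (Fin n)) (hX₀ : X₀ ∈ frontier K)
    (hcurv : HasPosGenCurvature K X₀) :
    ∀ ε > (0 : ℝ), ∃ K' : Set (EuclideanSpace ℝ (Fin n)),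
      IsConvexBody K' ∧ hausdorffDist K' K < ε ∧ isoL n K < isoL n K' := by
  obtain ⟨N, q, hq⟩ := hcurv
  obtain ⟨Q, hQ⟩ := isParaboloidal_of_curvWitness hK hX₀ hq
  obtain ⟨B, g, c, hB, hBpos, hvar⟩ := hK.exists_first_variation
  exact fun ε hε => hQ.exists_isoL_lt hn hK (hK.1.isClosed.frontier_subset hX₀) hB hBpos hvar hε
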